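/- (Estimate (3.7).) Let N ≥ 2 and N ≤ p < 2N − 1. There exists C > 0, depending only on N, p and the Littlewood–Paley function, such that for all u, B ∈ C_c^∞((0,∞)×ℝ^N; ℝ^N), the nonlinear term V₃(u,B) := ∑_{i,j=1}^N B_i A_{ij} ∂_j B satisfies ‖V₃(u,B)‖_{L¹(ℝ₊;Ḃ^{−1+N/p}_{p,1}(ℝ^N))} ≤ C ( 1 + ∑_{r=1}^{N−1} E(u)^r ) ‖D²B‖_{L¹(ℝ₊;Ḃ^{−1+N/p}_{p,1}(ℝ^N))} ‖∂_t B‖_{L¹(ℝ₊;Ḃ^{−1+N/p}_{p,1}(ℝ^N))}. -/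

import Mathlib

open MeasureTheory
open scoped BigOperators ENNReal

noncomputable section

namespace MHD

/-- A Littlewood–Paley function on a finite-dimensional real inner product space:
a nonnegative, smooth, radial, radially nonincreasing function equal to `1` on the unit
ball and supported in the ball of radius `2`. -/
structure LPF (V : Type*) [NormedAddCommGroup V] [InnerProductSpace ℝ V]
    [FiniteDimensional ℝ V] [MeasurableSpace V] [BorelSpace V] where
  chi : V → ℝ
  smooth : ContDiff ℝ (⊤ : ℕ∞) chi
  nonneg : ∀ x, 0 ≤ chi x
  radial : ∀ x y : V, ‖x‖ = ‖y‖ → chi x = chi y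
  radial_antitone : ∀ x y : V, ‖x‖ ≤ ‖y‖ → chi y ≤ chi x
  eq_one : ∀ x : V, ‖x‖ ≤ 1 → chi x = 1
  supp : ∀ x : V, 2 ≤ ‖x‖ → chi x = 0

variable {V : Type*} [NormedAddCommGroup V] [InnerProductSpace ℝ V]
    [FiniteDimensional ℝ V] [MeasurableSpace V] [BorelSpace V]

/-- `φ̂(ξ) = χ̂(ξ/2) − χ̂(ξ)`. -/
def LPF.phiHat (χ : LPF V) (ξ : V) : ℝ := χ.chi ((2 : ℝ)⁻¹ • ξ) - χ.chi ξ

/-- The `k`-th homogeneous Littlewood–Paley block `Δ̇_k f = 𝓕⁻¹(φ̂(2^{-k}·)·𝓕f)`. -/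
def LPF.block (χ : LPF V) (k : ℤ) (f : V → ℂ) : V → ℂ :=
  FourierTransformInv.fourierInv
    (fun ξ : V => ((χ.phiHat ((2 : ℝ) ^ (-k) • ξ) : ℝ) : ℂ) * FourierTransform.fourier f ξ)

/-- The `k`-th Littlewood–Paley kernel `𝓕⁻¹(φ̂(2^{-k}·))`. -/
def LPF.kernel (χ : LPF V) (k : ℤ) : V → ℂ :=
  FourierTransformInv.fourierInv (fun ξ : V => ((χ.phiHat ((2 : ℝ) ^ (-k) • ξ) : ℝ) : ℂ))

/-- The homogeneous Besov norm `‖f‖_{Ḃ^s_{p,1}} = ∑_{k∈ℤ} 2^{sk} ‖Δ̇_k f‖_{L^p} ∈ [0,∞]`. -/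
def besov (χ : LPF V) (s p : ℝ) (f : V → ℂ) : ℝ≥0∞ :=
  ∑' k : ℤ, ENNReal.ofReal ((2 : ℝ) ^ (s * (k : ℝ))) *
    eLpNorm (χ.block k f) (ENNReal.ofReal p) volume

/-- The space-time norm `∫_I ‖u(t,·)‖_{Ḃ^s_{p,1}} dt ∈ [0,∞]`. -/
def besovT (χ : LPF V) (s p : ℝ) (I : Set ℝ) (u : ℝ → V → ℂ) : ℝ≥0∞ :=
  ∫⁻ t in I, besov χ s p (u t)

/-- Euclidean space `ℝ^n`. -/
abbrev Euc (n : ℕ) := EuclideanSpace ℝ (Fin n)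

/-- Partial derivative `∂_i f` in the `i`-th coordinate direction. -/
def pdv {n : ℕ} {F : Type*} [NormedAddCommGroup F] [NormedSpace ℝ F]
    (i : Fin n) (f : Euc n → F) (y : Euc n) : F :=
  fderiv ℝ f y (EuclideanSpace.single i 1)

/-- `u ∈ C_c^∞((0,∞) × ℝ^N ; F)`. -/
def SmoothCpt (N : ℕ) {F : Type*} [NormedAddCommGroup F] [NormedSpace ℝ F]
    (u : ℝ → Euc N → F) : Prop :=
  ContDiff ℝ (⊤ : ℕ∞) (Function.uncurry u) ∧ HasCompactSupport (Function.uncurry u) ∧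
    ∀ t : ℝ, t ≤ 0 → ∀ y, u t y = 0

/-- `Q` is the family of cofactor polynomials: `Q i j` has zero constant term and
`adjugate (1 + M) i j = δ_{ij} + (Q i j)(M)` for every real `N × N` matrix `M`. -/
def IsCofactorPoly (N : ℕ) (Q : Fin N → Fin N → MvPolynomial (Fin N × Fin N) ℝ) : Prop :=
  ∀ i j : Fin N,
    MvPolynomial.constantCoeff (Q i j) = 0 ∧
    ∀ M : Matrix (Fin N) (Fin N) ℝ,
      Matrix.adjugate (1 + M) i j =
        (if i = j then (1 : ℝ) else 0) +
          MvPolynomial.eval (fun v : Fin N × Fin N => M v.1 v.2) (Q i j)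

/-- The matrix field `P_{ij}(t,y) = Q_{ij}(∫₀ᵗ Du(τ,y) dτ)`. -/
def Pmat {N : ℕ} (Q : Fin N → Fin N → MvPolynomial (Fin N × Fin N) ℝ)
    (u : ℝ → Euc N → Euc N) (t : ℝ) (y : Euc N) (i j : Fin N) : ℝ :=
  MvPolynomial.eval
    (fun v : Fin N × Fin N => ∫ τ in (0 : ℝ)..t, pdv v.2 (fun z => u τ z v.1) y) (Q i j)

/-- `E(u) = ‖D²u‖_{L¹(ℝ₊; Ḃ^s_{p,1}(ℝ^N))}`, summed over all components and all pairs of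
spatial derivatives. -/
def EE {N : ℕ} (χ : LPF (Euc N)) (s p : ℝ) (u : ℝ → Euc N → Euc N) : ℝ≥0∞ :=
  ∑ m : Fin N, ∑ i : Fin N, ∑ j : Fin N,
    besovT χ s p (Set.Ioi 0) (fun t y => ((pdv i (pdv j fun z => u t z m) y : ℝ) : ℂ))

/-- `‖∂_t u‖_{L¹(ℝ₊; Ḃ^s_{p,1}(ℝ^N))}`, summed over components. -/
def dtNorm {N : ℕ} (χ : LPF (Euc N)) (s p : ℝ) (u : ℝ → Euc N → Euc N) : ℝ≥0∞ :=
  ∑ m : Fin N,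
    besovT χ s p (Set.Ioi 0) (fun t y => ((deriv (fun τ => u τ y m) t : ℝ) : ℂ))

end MHD

open MHD

noncomputable section

namespace MHD

open scoped SchwartzMap FourierTransform Convolution LineDeriv
open ContinuousLinearMap (mul)

set_option linter.unusedSectionVars false

/-! ### Convolution inequalities -/

section Convolution

variable {V : Type*} [NormedAddCommGroup V] [InnerProductSpace ℝ V]
    [FiniteDimensional ℝ V] [MeasurableSpace V] [BorelSpace V]

lemma enorm_convolution_rpow_le {K h : V → ℂ} (hK : Measurable K) (hh : Measurable h)
    {q : ℝ} (hq : 1 ≤ q) (x : V) :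
    ‖(K ⋆[mul ℂ ℂ] h) x‖ₑ ^ q ≤
      (∫⁻ t, ‖K t‖ₑ) ^ (q - 1) * ∫⁻ t, ‖K t‖ₑ * ‖h (x - t)‖ₑ ^ q := by
  have hq0 : 0 < q := by linarith
  have h1 : ‖(K ⋆[mul ℂ ℂ] h) x‖ₑ ≤ ∫⁻ t, ‖K t‖ₑ * ‖h (x - t)‖ₑ := by
    refine (enorm_integral_le_lintegral_enorm _).trans_eq ?_
    simp [enorm_mul]
  have h2 : ∫⁻ t, ‖K t‖ₑ * ‖h (x - t)‖ₑ ≤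
      (∫⁻ t, ‖K t‖ₑ) ^ (1 - 1 / q) * (∫⁻ t, ‖K t‖ₑ * ‖h (x - t)‖ₑ ^ q) ^ (1 / q) := by
    have hp : (1 - 1 / q) + 1 / q = 1 := by ring
    have hp0 : 0 ≤ 1 - 1 / q := by
      rw [sub_nonneg, div_le_one hq0]; exact hq
    refine le_trans (le_of_eq ?_) (ENNReal.lintegral_mul_norm_pow_le
      (f := fun t => ‖K t‖ₑ) (g := fun t => ‖K t‖ₑ * ‖h (x - t)‖ₑ ^ q)
      (by fun_prop) (by fun_prop) hp0 (by positivity) hp)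
    congr 1; ext t
    rw [ENNReal.mul_rpow_of_nonneg _ _ (by positivity), ← mul_assoc,
      ← ENNReal.rpow_add_of_nonneg _ _ hp0 (by positivity), hp, ENNReal.rpow_one,
      ← ENNReal.rpow_mul, mul_one_div_cancel hq0.ne', ENNReal.rpow_one]
  calc ‖(K ⋆[mul ℂ ℂ] h) x‖ₑ ^ q
      ≤ ((∫⁻ t, ‖K t‖ₑ) ^ (1 - 1 / q) *
          (∫⁻ t, ‖K t‖ₑ * ‖h (x - t)‖ₑ ^ q) ^ (1 / q)) ^ q := by gcongr; exact h1.trans h2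
    _ = _ := by
      rw [ENNReal.mul_rpow_of_nonneg _ _ hq0.le, ← ENNReal.rpow_mul, ← ENNReal.rpow_mul,
        one_div_mul_cancel hq0.ne', ENNReal.rpow_one]
      congr 2; field_simp

lemma eLpNorm_rpow_eq (f : V → ℂ) {q : ℝ} (hq : 0 < q) :
    eLpNorm f (ENNReal.ofReal q) volume ^ q = ∫⁻ x, ‖f x‖ₑ ^ q := by
  rw [eLpNorm_eq_lintegral_rpow_enorm_toReal (by simpa using hq) ENNReal.ofReal_ne_top,
    ENNReal.toReal_ofReal hq.le, ← ENNReal.rpow_mul, one_div_mul_cancel hq.ne', ENNReal.rpow_one]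

lemma eLpNorm_convolution_le {K h : V → ℂ} (hK : Measurable K) (hh : Measurable h)
    {q : ℝ} (hq : 1 ≤ q) :
    eLpNorm (K ⋆[mul ℂ ℂ] h) (ENNReal.ofReal q) volume ≤
      (∫⁻ t, ‖K t‖ₑ) * eLpNorm h (ENNReal.ofReal q) volume := by
  have hq0 : 0 < q := by linarith
  rw [← ENNReal.rpow_le_rpow_iff hq0, ENNReal.mul_rpow_of_nonneg _ _ hq0.le,
    eLpNorm_rpow_eq _ hq0, eLpNorm_rpow_eq _ hq0]
  calc ∫⁻ x, ‖(K ⋆[mul ℂ ℂ] h) x‖ₑ ^ q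
      ≤ ∫⁻ x, (∫⁻ t, ‖K t‖ₑ) ^ (q - 1) * ∫⁻ t, ‖K t‖ₑ * ‖h (x - t)‖ₑ ^ q :=
        lintegral_mono fun x => enorm_convolution_rpow_le hK hh hq x
    _ = (∫⁻ t, ‖K t‖ₑ) ^ (q - 1) * ∫⁻ x, ∫⁻ t, ‖K t‖ₑ * ‖h (x - t)‖ₑ ^ q := by
        rw [lintegral_const_mul]
        exact Measurable.lintegral_prod_right' (f := fun z : V × V =>
          ‖K z.2‖ₑ * ‖h (z.1 - z.2)‖ₑ ^ q) (by fun_prop)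
    _ = (∫⁻ t, ‖K t‖ₑ) ^ (q - 1) * ∫⁻ t, ∫⁻ x, ‖K t‖ₑ * ‖h (x - t)‖ₑ ^ q := by
        rw [lintegral_lintegral_swap]
        exact (by fun_prop : Measurable (fun z : V × V =>
          ‖K z.2‖ₑ * ‖h (z.1 - z.2)‖ₑ ^ q)).aemeasurable
    _ = (∫⁻ t, ‖K t‖ₑ) ^ (q - 1) * ((∫⁻ t, ‖K t‖ₑ) * ∫⁻ x, ‖h x‖ₑ ^ q) := by
        congr 1
        rw [← lintegral_mul_const _ (by fun_prop)]
        congr 1; ext t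
        rw [lintegral_const_mul _ (by fun_prop),
          lintegral_sub_right_eq_self (fun x => ‖h x‖ₑ ^ q) t]
    _ = _ := by
        rw [← mul_assoc]
        congr 1
        nth_rewrite 2 [← ENNReal.rpow_one (∫⁻ t, ‖K t‖ₑ)]
        rw [← ENNReal.rpow_add_of_nonneg _ _ (by linarith) zero_le_one]
        congr 1; ring

lemma enorm_convolution_le {K h : V → ℂ} (hK : Measurable K) (hh : Measurable h)
    {q : ℝ} (hq : 1 ≤ q) {S : ℝ≥0∞} (hS : ∀ t, ‖K t‖ₑ ≤ S) (x : V) :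
    ‖(K ⋆[mul ℂ ℂ] h) x‖ₑ ≤
      (∫⁻ t, ‖K t‖ₑ) ^ (1 - 1 / q) * S ^ (1 / q) * eLpNorm h (ENNReal.ofReal q) volume := by
  have hq0 : 0 < q := by linarith
  rw [← ENNReal.rpow_le_rpow_iff hq0, ENNReal.mul_rpow_of_nonneg _ _ hq0.le,
    ENNReal.mul_rpow_of_nonneg _ _ hq0.le, eLpNorm_rpow_eq _ hq0, ← ENNReal.rpow_mul,
    ← ENNReal.rpow_mul, one_div_mul_cancel hq0.ne', ENNReal.rpow_one, mul_assoc]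
  have e : (1 - 1 / q) * q = q - 1 := by field_simp
  rw [e]
  refine (enorm_convolution_rpow_le hK hh hq x).trans ?_
  gcongr
  calc ∫⁻ t, ‖K t‖ₑ * ‖h (x - t)‖ₑ ^ q ≤ ∫⁻ t, S * ‖h (x - t)‖ₑ ^ q := by
        gcongr with t; exact hS t
    _ = S * ∫⁻ t, ‖h t‖ₑ ^ q := by
        rw [lintegral_const_mul _ (by fun_prop),
          lintegral_sub_left_eq_self (fun t => ‖h t‖ₑ ^ q) x]

lemma eLpNorm_two_mul_le {F : V → ℂ} (hF : Measurable F) {q : ℝ} (hq : 0 < q) {M : ℝ≥0∞}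
    (hM : ∀ x, ‖F x‖ₑ ≤ M) :
    eLpNorm F (ENNReal.ofReal (2 * q)) volume ≤
      M ^ (1 / 2 : ℝ) * eLpNorm F (ENNReal.ofReal q) volume ^ (1 / 2 : ℝ) := by
  have h2 : 0 < 2 * q := by linarith
  have e : 1 / 2 * (2 * q) = q := by ring
  rw [← ENNReal.rpow_le_rpow_iff h2, ENNReal.mul_rpow_of_nonneg _ _ h2.le, ← ENNReal.rpow_mul,
    ← ENNReal.rpow_mul, e, eLpNorm_rpow_eq _ h2, eLpNorm_rpow_eq _ hq,
    ← lintegral_const_mul _ (by fun_prop)]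
  refine lintegral_mono fun x => ?_
  rw [two_mul, ENNReal.rpow_add_of_nonneg _ _ hq.le hq.le]
  gcongr
  exact hM x

end Convolution

/-! ### Dyadic Fourier multipliers on Schwartz functions -/

/-- The weight `2 ^ x` as an extended nonnegative real. -/
def wt (x : ℝ) : ℝ≥0∞ := ENNReal.ofReal ((2 : ℝ) ^ x)

lemma wt_add (x y : ℝ) : wt (x + y) = wt x * wt y := by
  rw [wt, wt, wt, Real.rpow_add two_pos, ENNReal.ofReal_mul (by positivity)]

lemma wt_zero : wt 0 = 1 := by simp [wt]

lemma wt_mono {x y : ℝ} (h : x ≤ y) : wt x ≤ wt y :=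
  ENNReal.ofReal_le_ofReal (Real.rpow_le_rpow_of_exponent_le one_le_two h)

lemma wt_ne_top (x : ℝ) : wt x ≠ ∞ := ENNReal.ofReal_ne_top

lemma wt_rpow (x y : ℝ) : wt x ^ y = wt (x * y) := by
  rw [wt, wt, ENNReal.ofReal_rpow_of_pos (by positivity), Real.rpow_mul two_pos.le]

section Multiplier

variable {V : Type*} [NormedAddCommGroup V] [InnerProductSpace ℝ V]
    [FiniteDimensional ℝ V] [MeasurableSpace V] [BorelSpace V]

/-- Pointwise product of Schwartz functions. -/
def pmul (m f : 𝓢(V, ℂ)) : 𝓢(V, ℂ) := SchwartzMap.pairing (mul ℂ ℂ) m f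

@[simp] lemma pmul_apply (m f : 𝓢(V, ℂ)) (x : V) : pmul m f x = m x * f x := rfl

/-- Fourier multiplier with symbol `m`. -/
def mult (m f : 𝓢(V, ℂ)) : 𝓢(V, ℂ) := 𝓕⁻ (pmul m (𝓕 f))

lemma fourier_mult (m f : 𝓢(V, ℂ)) : 𝓕 (mult m f) = pmul m (𝓕 f) := by simp [mult]

lemma mult_eq_convolution (m f : 𝓢(V, ℂ)) (x : V) :
    mult m f x = ((𝓕⁻ m : 𝓢(V, ℂ)) ⋆[mul ℂ ℂ] f) x := by
  rw [← SchwartzMap.convolution_apply]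
  simp [SchwartzMap.convolution, mult, pmul]

lemma mult_mult (m n f : 𝓢(V, ℂ)) : mult m (mult n f) = mult (pmul m n) f := by
  rw [mult, fourier_mult, mult]
  congr 1; ext x; simp [mul_assoc]

lemma mult_smul (m f : 𝓢(V, ℂ)) (c : ℂ) : mult m (c • f) = c • mult m f := by
  simp only [mult, FourierTransform.fourier_smul, pmul, map_smul,
    FourierTransform.fourierInv_smul]

/-- Dyadic dilation `ξ ↦ m (2^{-k} ξ)`. -/
def dil (k : ℤ) (m : 𝓢(V, ℂ)) : 𝓢(V, ℂ) :=
  SchwartzMap.compCLMOfContinuousLinearEquiv ℂ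
    (ContinuousLinearEquiv.smulLeft (Units.mk0 ((2 : ℝ) ^ (-k)) (by positivity)) : V ≃L[ℝ] V) m

@[simp] lemma dil_apply (k : ℤ) (m : 𝓢(V, ℂ)) (ξ : V) : dil k m ξ = m ((2 : ℝ) ^ (-k) • ξ) := rfl

lemma wt_finrank (k : ℤ) :
    wt (k * Module.finrank ℝ V) = ENNReal.ofReal |((2 : ℝ) ^ (-k)) ^ Module.finrank ℝ V|⁻¹ := by
  rw [wt]; congr 1
  rw [abs_of_pos (by positivity), Real.rpow_mul two_pos.le, Real.rpow_natCast, Real.rpow_intCast,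
    zpow_neg, inv_pow, inv_inv]

lemma lintegral_dil (k : ℤ) (f : V → ℝ≥0∞) :
    ∫⁻ x, f ((2 : ℝ) ^ (-k) • x) = wt (k * Module.finrank ℝ V) * ∫⁻ x, f x := by
  have h0 : (2 : ℝ) ^ (-k) ≠ 0 := by positivity
  refine ((Homeomorph.smulOfNeZero (α := V) _ h0).measurableEmbedding.lintegral_map
    (μ := volume) f).symm.trans ?_
  change ∫⁻ x, f x ∂(Measure.map (fun x => (2 : ℝ) ^ (-k) • x) volume) = _
  rw [Measure.map_addHaar_smul _ h0, lintegral_smul_measure, smul_eq_mul, wt_finrank, abs_inv]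

lemma fourierInv_dil (k : ℤ) (m : 𝓢(V, ℂ)) (x : V) :
    ‖𝓕⁻ (dil k m) x‖ₑ = wt (k * Module.finrank ℝ V) * ‖𝓕⁻ m ((2 : ℝ) ^ k • x)‖ₑ := by
  have h := Measure.integral_comp_smul (volume : Measure V)
    (fun v => Real.fourierChar (inner ℝ v ((2 : ℝ) ^ k • x)) • m v) ((2 : ℝ) ^ (-k))
  have e : (fun v => Real.fourierChar (inner ℝ ((2 : ℝ) ^ (-k) • v) ((2 : ℝ) ^ k • x)) •
      m ((2 : ℝ) ^ (-k) • v)) = fun v => Real.fourierChar (inner ℝ v x) • dil k m v := by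
    ext v
    rw [real_inner_smul_left, real_inner_smul_right, ← mul_assoc, ← zpow_add₀ two_ne_zero]
    simp
  rw [SchwartzMap.fourierInv_coe, SchwartzMap.fourierInv_coe, Real.fourierInv_eq,
    Real.fourierInv_eq, ← e, h, enorm_smul, wt_finrank, abs_inv,
    Real.enorm_eq_ofReal (by positivity)]

lemma lintegral_fourierInv_dil (k : ℤ) (m : 𝓢(V, ℂ)) :
    ∫⁻ x, ‖𝓕⁻ (dil k m) x‖ₑ = ∫⁻ x, ‖𝓕⁻ m x‖ₑ := by
  simp_rw [fourierInv_dil]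
  have := lintegral_dil (V := V) (-k) (fun x => ‖𝓕⁻ m x‖ₑ)
  simp only [neg_neg] at this
  rw [lintegral_const_mul' _ _ (wt_ne_top _), this, ← mul_assoc, ← wt_add]
  simp [wt_zero]

lemma enorm_fourierInv_dil_le (k : ℤ) (m : 𝓢(V, ℂ)) (x : V) :
    ‖𝓕⁻ (dil k m) x‖ₑ ≤ wt (k * Module.finrank ℝ V) * ∫⁻ x, ‖m x‖ₑ := by
  rw [fourierInv_dil]
  gcongr
  rw [SchwartzMap.fourierInv_coe, Real.fourierInv_eq]
  refine (enorm_integral_le_lintegral_enorm _).trans_eq ?_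
  refine lintegral_congr fun v => ?_
  rw [← ofReal_norm, ← ofReal_norm, Circle.norm_smul]

lemma lintegral_enorm_ne_top (m : 𝓢(V, ℂ)) : ∫⁻ x, ‖m x‖ₑ ≠ ∞ :=
  m.integrable.hasFiniteIntegral.ne

/-- A multiplier and its dyadic dilations are bounded on `L^q`, uniformly in the scale. -/
lemma eLpNorm_mult_le (m : 𝓢(V, ℂ)) : ∃ C : ℝ≥0∞, C ≠ ∞ ∧ ∀ (k : ℤ) (q : ℝ), 1 ≤ q →
    ∀ f : 𝓢(V, ℂ), eLpNorm (mult (dil k m) f) (ENNReal.ofReal q) volume ≤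
      C * eLpNorm f (ENNReal.ofReal q) volume := by
  refine ⟨∫⁻ x, ‖𝓕⁻ m x‖ₑ, lintegral_enorm_ne_top _, fun k q hq f => ?_⟩
  rw [← lintegral_fourierInv_dil k, funext (mult_eq_convolution (dil k m) f)]
  exact eLpNorm_convolution_le (SchwartzMap.continuous _).measurable f.continuous.measurable hq

/-- Bernstein inequality `L^q → L^∞`. -/
lemma enorm_mult_le (m : 𝓢(V, ℂ)) {q : ℝ} (hq : 1 ≤ q) : ∃ C : ℝ≥0∞, C ≠ ∞ ∧
    ∀ (k : ℤ) (f : 𝓢(V, ℂ)) (x : V), ‖mult (dil k m) f x‖ₑ ≤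
      C * wt (k * (Module.finrank ℝ V / q)) * eLpNorm f (ENNReal.ofReal q) volume := by
  have hq0 : 0 < q := by linarith
  have hq1 : 0 ≤ 1 - 1 / q := by rw [sub_nonneg, div_le_one hq0]; exact hq
  refine ⟨(∫⁻ x, ‖𝓕⁻ m x‖ₑ) ^ (1 - 1 / q) * (∫⁻ x, ‖m x‖ₑ) ^ (1 / q),
    ENNReal.mul_ne_top (ENNReal.rpow_ne_top_of_nonneg hq1 (lintegral_enorm_ne_top _))
      (ENNReal.rpow_ne_top_of_nonneg (by positivity) (lintegral_enorm_ne_top _)),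
    fun k f x => ?_⟩
  rw [mult_eq_convolution]
  refine (enorm_convolution_le (SchwartzMap.continuous _).measurable f.continuous.measurable hq
    (enorm_fourierInv_dil_le k m) x).trans_eq ?_
  rw [lintegral_fourierInv_dil, ENNReal.mul_rpow_of_nonneg _ _ (by positivity), wt_rpow,
    show (k : ℝ) * Module.finrank ℝ V * (1 / q) = k * (Module.finrank ℝ V / q) by ring]
  ring

/-- Bernstein inequality `L^q → L^{2q}`. -/
lemma eLpNorm_two_mul_mult_le (m : 𝓢(V, ℂ)) {q : ℝ} (hq : 1 ≤ q) : ∃ C : ℝ≥0∞, C ≠ ∞ ∧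
    ∀ (k : ℤ) (f : 𝓢(V, ℂ)), eLpNorm (mult (dil k m) f) (ENNReal.ofReal (2 * q)) volume ≤
      C * wt (k * (Module.finrank ℝ V / (2 * q))) * eLpNorm f (ENNReal.ofReal q) volume := by
  obtain ⟨C₁, h₁, H₁⟩ := eLpNorm_mult_le m
  obtain ⟨C₂, h₂, H₂⟩ := enorm_mult_le m hq
  refine ⟨C₂ ^ (1 / 2 : ℝ) * C₁ ^ (1 / 2 : ℝ),
    ENNReal.mul_ne_top (ENNReal.rpow_ne_top_of_nonneg (by positivity) h₂)
      (ENNReal.rpow_ne_top_of_nonneg (by positivity) h₁), fun k f => ?_⟩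
  refine (eLpNorm_two_mul_le (SchwartzMap.continuous _).measurable (by linarith)
    (H₂ k f)).trans ?_
  calc _ ≤ (C₂ * wt (k * (Module.finrank ℝ V / q)) * eLpNorm f (ENNReal.ofReal q) volume) ^
        (1 / 2 : ℝ) * (C₁ * eLpNorm f (ENNReal.ofReal q) volume) ^ (1 / 2 : ℝ) := by
        gcongr; exact H₁ k q hq f
    _ = C₂ ^ (1 / 2 : ℝ) * C₁ ^ (1 / 2 : ℝ) * wt (k * (Module.finrank ℝ V / (2 * q))) *
        (eLpNorm f (ENNReal.ofReal q) volume ^ (1 / 2 : ℝ) *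
          eLpNorm f (ENNReal.ofReal q) volume ^ (1 / 2 : ℝ)) := by
        simp only [ENNReal.mul_rpow_of_nonneg _ _ (by norm_num : (0 : ℝ) ≤ 1 / 2), wt_rpow]
        rw [show (k : ℝ) * (Module.finrank ℝ V / q) * (1 / 2) =
          k * (Module.finrank ℝ V / (2 * q)) by field_simp]
        ring
    _ = _ := by
        rw [← ENNReal.rpow_add_of_nonneg _ _ (by norm_num) (by norm_num)]
        norm_num

end Multiplier

/-! ### Littlewood–Paley blocks of Schwartz functions -/

section Blocks

variable {V : Type*} [NormedAddCommGroup V] [InnerProductSpace ℝ V]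
    [FiniteDimensional ℝ V] [MeasurableSpace V] [BorelSpace V]

/-- A real smooth function vanishing outside a ball, as a complex Schwartz function. -/
def bumpS (g : V → ℝ) (hg : ContDiff ℝ (⊤ : ℕ∞) g) (R : ℝ) (hR : ∀ x, R < ‖x‖ → g x = 0) :
    𝓢(V, ℂ) :=
  HasCompactSupport.toSchwartzMap (f := fun x => (g x : ℂ))
    (HasCompactSupport.intro (isCompact_closedBall 0 R) fun x hx => by
      rw [hR x (by simpa using hx), Complex.ofReal_zero])
    (Complex.ofRealCLM.contDiff.comp hg)

@[simp] lemma bumpS_apply (g : V → ℝ) (hg : ContDiff ℝ (⊤ : ℕ∞) g) (R : ℝ)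
    (hR : ∀ x, R < ‖x‖ → g x = 0) (x : V) : bumpS g hg R hR x = (g x : ℂ) := rfl

lemma coeS_smul (c : ℂ) (f : 𝓢(V, ℂ)) : ⇑(c • f) = c • ⇑f := rfl

lemma coeS_sum {ι : Type*} (s : Finset ι) (f : ι → 𝓢(V, ℂ)) :
    ⇑(∑ i ∈ s, f i) = ∑ i ∈ s, ⇑(f i) := by
  ext x
  rw [Finset.sum_apply, _root_.sum_apply]

variable (χ : LPF V)

lemma LPF.chi_smul_eq_zero {c : ℝ} (hc : 0 < c) {x : V} (h : 2 / c ≤ ‖x‖) :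
    χ.chi (c • x) = 0 := by
  refine χ.supp _ ?_
  rw [norm_smul, Real.norm_of_nonneg hc.le]
  rwa [div_le_iff₀' hc] at h

lemma LPF.chi_smul_eq_one {c : ℝ} (hc : 0 < c) {x : V} (h : ‖x‖ ≤ 1 / c) :
    χ.chi (c • x) = 1 := by
  refine χ.eq_one _ ?_
  rw [norm_smul, Real.norm_of_nonneg hc.le]
  rwa [le_div_iff₀' hc] at h

lemma LPF.contDiff_chi_smul (c : ℝ) : ContDiff ℝ (⊤ : ℕ∞) (fun x => χ.chi (c • x)) :=
  χ.smooth.comp (contDiff_const_smul c)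

lemma LPF.phiHat_eq_zero_of_le {x : V} (h : ‖x‖ ≤ 1) : χ.phiHat x = 0 := by
  rw [LPF.phiHat, χ.chi_smul_eq_one (by norm_num) (by norm_num; linarith), χ.eq_one x h, sub_self]

lemma LPF.phiHat_eq_zero_of_ge {x : V} (h : 4 ≤ ‖x‖) : χ.phiHat x = 0 := by
  rw [LPF.phiHat, χ.chi_smul_eq_zero (by norm_num) (by norm_num; linarith),
    χ.supp x (by linarith), sub_self]

lemma LPF.contDiff_phiHat : ContDiff ℝ (⊤ : ℕ∞) χ.phiHat :=
  (χ.contDiff_chi_smul _).sub χ.smooth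

/-- The Littlewood–Paley symbol as a Schwartz function. -/
def LPF.phi : 𝓢(V, ℂ) :=
  bumpS χ.phiHat χ.contDiff_phiHat 4 fun _ hx =>
    χ.phiHat_eq_zero_of_ge hx.le

lemma LPF.phi_ne_zero {x : V} (h : χ.phi x ≠ 0) : 1 < ‖x‖ ∧ ‖x‖ < 4 := by
  have h' : χ.phiHat x ≠ 0 := by
    rw [LPF.phi, bumpS_apply] at h
    exact_mod_cast h
  constructor
  · by_contra! hx; exact h' (χ.phiHat_eq_zero_of_le hx)
  · by_contra! hx; exact h' (χ.phiHat_eq_zero_of_ge hx)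

/-- An enlarged annular cutoff, equal to `1` on the support of `φ̂`. -/
def LPF.fatHat (ξ : V) : ℝ := χ.chi ((4 : ℝ)⁻¹ • ξ) - χ.chi ((2 : ℝ) • ξ)

lemma LPF.fatHat_eq_zero_of_le {x : V} (h : ‖x‖ ≤ 1 / 2) : χ.fatHat x = 0 := by
  rw [LPF.fatHat, χ.chi_smul_eq_one (by norm_num) (by norm_num; linarith),
    χ.chi_smul_eq_one (by norm_num) (by linarith), sub_self]

lemma LPF.fatHat_eq_zero_of_ge {x : V} (h : 8 ≤ ‖x‖) : χ.fatHat x = 0 := by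
  rw [LPF.fatHat, χ.chi_smul_eq_zero (by norm_num) (by norm_num; linarith),
    χ.chi_smul_eq_zero (by norm_num) (by norm_num; linarith), sub_self]

lemma LPF.fatHat_eq_one {x : V} (h : 1 ≤ ‖x‖) (h' : ‖x‖ ≤ 4) : χ.fatHat x = 1 := by
  rw [LPF.fatHat, χ.chi_smul_eq_one (by norm_num) (by norm_num; linarith),
    χ.chi_smul_eq_zero (by norm_num) (by norm_num; linarith), sub_zero]

lemma LPF.contDiff_fatHat : ContDiff ℝ (⊤ : ℕ∞) χ.fatHat :=
  (χ.contDiff_chi_smul _).sub (χ.contDiff_chi_smul _)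

/-- The enlarged cutoff as a Schwartz function. -/
def LPF.fat : 𝓢(V, ℂ) :=
  bumpS χ.fatHat χ.contDiff_fatHat 8 fun _ hx => χ.fatHat_eq_zero_of_ge hx.le

lemma LPF.contDiff_fatHat_div (e : V) :
    ContDiff ℝ (⊤ : ℕ∞) (fun ξ => χ.fatHat ξ * (inner ℝ ξ e / ‖ξ‖ ^ 2)) := by
  rw [contDiff_iff_contDiffAt]
  intro x
  by_cases hx : x = 0
  · have : (fun ξ => χ.fatHat ξ * (inner ℝ ξ e / ‖ξ‖ ^ 2)) =ᶠ[nhds x] fun _ => 0 := by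
      filter_upwards [Metric.ball_mem_nhds x (by norm_num : (0 : ℝ) < 1 / 2)] with y hy
      rw [hx, mem_ball_zero_iff] at hy
      rw [χ.fatHat_eq_zero_of_le hy.le, zero_mul]
    exact contDiffAt_const.congr_of_eventuallyEq this
  · refine χ.contDiff_fatHat.contDiffAt.mul (ContDiffAt.div ?_ ?_ (by simpa using hx))
    · exact (contDiff_id.inner ℝ contDiff_const).contDiffAt
    · exact (contDiff_norm_sq ℝ).contDiffAt

/-- The symbol recovering a block from the corresponding directional derivative. -/
def LPF.gradSym (e : V) : 𝓢(V, ℂ) :=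
  bumpS (fun ξ => χ.fatHat ξ * (inner ℝ ξ e / ‖ξ‖ ^ 2)) (χ.contDiff_fatHat_div e) 8
    fun _ hx => by rw [χ.fatHat_eq_zero_of_ge hx.le, zero_mul]

/-- The Littlewood–Paley block of a Schwartz function. -/
def LPF.blockS (k : ℤ) (f : 𝓢(V, ℂ)) : 𝓢(V, ℂ) := mult (dil k χ.phi) f

lemma LPF.coe_blockS (k : ℤ) (f : 𝓢(V, ℂ)) : (χ.blockS k f : V → ℂ) = χ.block k f := by
  rw [LPF.blockS, mult, SchwartzMap.fourierInv_coe]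
  rfl

lemma LPF.mult_fat_blockS (k : ℤ) (f : 𝓢(V, ℂ)) :
    mult (dil k χ.fat) (χ.blockS k f) = χ.blockS k f := by
  rw [LPF.blockS, mult_mult]
  congr 1
  ext ξ
  by_cases h : χ.phi ((2 : ℝ) ^ (-k) • ξ) = 0
  · simp only [pmul_apply, dil_apply, h, mul_zero]
  · have := χ.phi_ne_zero h
    have h1 : χ.fat ((2 : ℝ) ^ (-k) • ξ) = 1 := by
      rw [LPF.fat, bumpS_apply, χ.fatHat_eq_one this.1.le this.2.le, Complex.ofReal_one]
    simp only [pmul_apply, dil_apply, h1, one_mul]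

lemma LPF.enorm_blockS_le {q : ℝ} (hq : 1 ≤ q) : ∃ C : ℝ≥0∞, C ≠ ∞ ∧
    ∀ (k : ℤ) (f : 𝓢(V, ℂ)) (x : V), ‖χ.blockS k f x‖ₑ ≤
      C * wt (k * (Module.finrank ℝ V / q)) * eLpNorm (χ.blockS k f) (ENNReal.ofReal q) volume := by
  obtain ⟨C, hC, H⟩ := enorm_mult_le χ.fat hq
  refine ⟨C, hC, fun k f x => ?_⟩
  have := H k (χ.blockS k f) x
  rwa [χ.mult_fat_blockS] at this

lemma LPF.sum_mult_gradSym {ι : Type*} [Fintype ι] (b : OrthonormalBasis ι ℝ V) (k : ℤ)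
    (f : 𝓢(V, ℂ)) :
    ∑ i, mult (dil k (χ.gradSym (b i))) (χ.blockS k (∂_{b i} f)) =
      (2 * Real.pi * Complex.I * (2 : ℂ) ^ k) • χ.blockS k f := by
  have hinj : Function.Injective (fun g : 𝓢(V, ℂ) => 𝓕 g) :=
    (FourierTransform.fourierEquiv ℂ 𝓢(V, ℂ)).injective
  apply hinj
  simp only [FourierTransform.fourier_sum, FourierTransform.fourier_smul, LPF.blockS, fourier_mult]
  ext ξ
  simp only [_root_.sum_apply, smul_apply, pmul_apply, dil_apply, smul_eq_mul]
  set η := (2 : ℝ) ^ (-k) • ξ with hη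
  have hξ : ξ = (2 : ℝ) ^ k • η := by
    rw [hη, smul_smul, ← zpow_add₀ two_ne_zero]; simp
  by_cases h : χ.phi η = 0
  · simp [h]
  have hη1 := χ.phi_ne_zero h
  have hd : ∀ i, 𝓕 (∂_{b i} f) ξ =
      2 * Real.pi * Complex.I * ((inner ℝ ξ (b i) : ℝ) : ℂ) * 𝓕 f ξ := fun i => by
    have ht : (inner ℝ · (b i) : V → ℝ).HasTemperateGrowth :=
      ((innerSL ℝ).flip (b i)).hasTemperateGrowth
    rw [SchwartzMap.fourier_lineDerivOp_eq, smul_apply, SchwartzMap.smulLeftCLM_apply_apply ht]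
    simp [mul_assoc]
  have hg : ∀ i, χ.gradSym (b i) η = ((inner ℝ η (b i) / ‖η‖ ^ 2 : ℝ) : ℂ) := fun i => by
    rw [LPF.gradSym, bumpS_apply, χ.fatHat_eq_one hη1.1.le hη1.2.le, one_mul]
  have hn : (‖η‖ : ℂ) ^ 2 ≠ 0 := by
    have : ‖η‖ ≠ 0 := by linarith
    exact_mod_cast pow_ne_zero 2 this
  have hs : ∑ i, ((inner ℝ η (b i) : ℝ) : ℂ) ^ 2 = (‖η‖ : ℂ) ^ 2 := by
    exact_mod_cast b.sum_sq_inner_left η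
  have hi : ∀ i, ((inner ℝ ξ (b i) : ℝ) : ℂ) = (2 : ℂ) ^ k * ((inner ℝ η (b i) : ℝ) : ℂ) :=
    fun i => by
      rw [hξ, real_inner_smul_left]; push_cast; ring
  calc _ = ∑ i, ((inner ℝ η (b i) : ℝ) : ℂ) ^ 2 * (2 * Real.pi * Complex.I * (2 : ℂ) ^ k *
        (χ.phi η * 𝓕 f ξ) / (‖η‖ : ℂ) ^ 2) := by
        refine Finset.sum_congr rfl fun i _ => ?_
        rw [hd, hg, hi]; push_cast; ring
    _ = _ := by
        rw [← Finset.sum_mul, hs, mul_div_cancel₀ _ hn]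

lemma LPF.wt_mul_eLpNorm_blockS_le {ι : Type*} [Fintype ι] (b : OrthonormalBasis ι ℝ V) {q : ℝ}
    (hq : 1 ≤ q) : ∃ C : ℝ≥0∞, C ≠ ∞ ∧ ∀ (k : ℤ) (f : 𝓢(V, ℂ)),
      wt k * eLpNorm (χ.blockS k f) (ENNReal.ofReal q) volume ≤
        C * ∑ i, eLpNorm (χ.blockS k (∂_{b i} f)) (ENNReal.ofReal q) volume := by
  choose C hC H using fun i => eLpNorm_mult_le (χ.gradSym (b i))
  refine ⟨∑ i, C i, ENNReal.sum_ne_top.2 fun i _ => hC i, fun k f => ?_⟩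
  have h1 : wt k * eLpNorm (χ.blockS k f) (ENNReal.ofReal q) volume ≤
      eLpNorm ((2 * Real.pi * Complex.I * (2 : ℂ) ^ k) • χ.blockS k f) (ENNReal.ofReal q)
        volume := by
    rw [coeS_smul, eLpNorm_const_smul]
    gcongr
    rw [enorm_eq_nnnorm, wt, ENNReal.ofReal, ENNReal.coe_le_coe,
      Real.toNNReal_le_iff_le_coe, coe_nnnorm, norm_mul, norm_zpow, Real.rpow_intCast]
    have h2 : ‖(2 * Real.pi * Complex.I : ℂ)‖ = 2 * Real.pi := by
      simp [abs_of_pos Real.pi_pos]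
    rw [h2, Complex.norm_ofNat]
    exact le_mul_of_one_le_left (by positivity) (by linarith [Real.pi_gt_three])
  refine h1.trans ?_
  rw [← χ.sum_mult_gradSym b]
  calc _ ≤ ∑ i, eLpNorm (mult (dil k (χ.gradSym (b i))) (χ.blockS k (∂_{b i} f)))
        (ENNReal.ofReal q) volume := by
        rw [coeS_sum]
        exact eLpNorm_sum_le (fun i _ => (SchwartzMap.continuous _).aestronglyMeasurable)
          (by simpa using hq)
    _ ≤ ∑ i, C i * eLpNorm (χ.blockS k (∂_{b i} f)) (ENNReal.ofReal q) volume :=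
        Finset.sum_le_sum fun i _ => H i k q hq _
    _ ≤ ∑ i, (∑ i, C i) * eLpNorm (χ.blockS k (∂_{b i} f)) (ENNReal.ofReal q) volume := by
        gcongr with i
        exact Finset.single_le_sum (f := C) (fun _ _ => zero_le) (Finset.mem_univ i)
    _ = _ := by rw [Finset.mul_sum]

lemma fourier_pmul_eq_zero {F G : 𝓢(V, ℂ)} {ξ : V} (h : ∀ η, 𝓕 F η * 𝓕 G (ξ - η) = 0) :
    𝓕 (pmul F G) ξ = 0 := by
  have hneg : ∀ (H : 𝓢(V, ℂ)) (x : V), 𝓕⁻ H x = 𝓕 H (-x) := fun H x => by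
    rw [SchwartzMap.fourierInv_coe, SchwartzMap.fourier_coe, Real.fourierInv_eq_fourier_neg]
  have h1 : 𝓕⁻ (pmul F G) = SchwartzMap.convolution (mul ℂ ℂ) (𝓕⁻ F) (𝓕⁻ G) := by
    simp [SchwartzMap.convolution, pmul]
  rw [← neg_neg ξ, ← hneg, h1, SchwartzMap.convolution_apply, convolution]
  refine integral_eq_zero_of_ae (Filter.Eventually.of_forall fun t => ?_)
  have := h (-t)
  simp only [ContinuousLinearMap.mul_apply', hneg, Pi.zero_apply]
  rw [← this]; congr 2; abel

lemma LPF.fourier_blockS_ne_zero {k : ℤ} {f : 𝓢(V, ℂ)} {ξ : V} (h : 𝓕 (χ.blockS k f) ξ ≠ 0) :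
    (2 : ℝ) ^ k < ‖ξ‖ ∧ ‖ξ‖ < (2 : ℝ) ^ (k + 2) := by
  rw [LPF.blockS, fourier_mult, pmul_apply] at h
  have h1 := χ.phi_ne_zero (x := (2 : ℝ) ^ (-k) • ξ) (left_ne_zero_of_mul h)
  have h2 : (0 : ℝ) < 2 ^ k := by positivity
  rw [norm_smul, Real.norm_of_nonneg (by positivity), zpow_neg, inv_mul_eq_div, lt_div_iff₀ h2,
    div_lt_iff₀ h2] at h1
  refine ⟨by linarith, ?_⟩
  rw [zpow_add₀ two_ne_zero]
  norm_num
  linarith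

/-- The block `Δ̇_k (Δ̇_j f Δ̇_l g)` vanishes unless the three frequencies interact. -/
lemma LPF.blockS_pmul_eq_zero {j k l : ℤ} {f g : 𝓢(V, ℂ)}
    (h : max j l + 3 ≤ k ∨ (l + 3 ≤ j ∧ k + 3 ≤ j) ∨ (j + 3 ≤ l ∧ k + 3 ≤ l)) :
    χ.blockS k (pmul (χ.blockS j f) (χ.blockS l g)) = 0 := by
  have key : pmul (dil k χ.phi) (𝓕 (pmul (χ.blockS j f) (χ.blockS l g))) = 0 := by
    ext ξ
    by_cases hξ : χ.phi ((2 : ℝ) ^ (-k) • ξ) = 0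
    · rw [pmul_apply, dil_apply, hξ, zero_mul]; rfl
    have hk := χ.phi_ne_zero hξ
    have h2 : (0 : ℝ) < 2 ^ k := by positivity
    rw [norm_smul, Real.norm_of_nonneg (by positivity), zpow_neg, inv_mul_eq_div, lt_div_iff₀ h2,
      div_lt_iff₀ h2, one_mul] at hk
    have h4 : (4 : ℝ) * 2 ^ k = 2 ^ (k + 2) := by rw [zpow_add₀ two_ne_zero]; norm_num; ring
    rw [h4] at hk
    rw [pmul_apply, fourier_pmul_eq_zero, mul_zero]
    · rfl
    intro η
    by_contra hne
    have hj := χ.fourier_blockS_ne_zero (left_ne_zero_of_mul hne)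
    have hl := χ.fourier_blockS_ne_zero (right_ne_zero_of_mul hne)
    have mono : ∀ {a b : ℤ}, a ≤ b → (2 : ℝ) ^ a ≤ 2 ^ b := fun h =>
      zpow_le_zpow_right₀ one_le_two h
    have dbl : ∀ a : ℤ, (2 : ℝ) ^ (a + 1) = 2 ^ a + 2 ^ a := fun a => by
      rw [zpow_add₀ two_ne_zero]; ring
    have t1 : ‖ξ‖ ≤ ‖η‖ + ‖ξ - η‖ := by simpa using norm_add_le η (ξ - η)
    have t2 : ‖η‖ ≤ ‖ξ‖ + ‖ξ - η‖ := by simpa using norm_sub_le ξ (ξ - η)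
    have t3 : ‖ξ - η‖ ≤ ‖ξ‖ + ‖η‖ := norm_sub_le _ _
    rcases h with h | ⟨h, h'⟩ | ⟨h, h'⟩
    · have m1 := mono (show j + 2 ≤ k - 1 by have := le_max_left j l; omega)
      have m2 := mono (show l + 2 ≤ k - 1 by have := le_max_right j l; omega)
      have := dbl (k - 1)
      rw [sub_add_cancel] at this
      linarith
    · have m1 := mono (show k + 2 ≤ j - 1 by omega)
      have m2 := mono (show l + 2 ≤ j - 1 by omega)
      have := dbl (j - 1)
      rw [sub_add_cancel] at this
      linarith
    · have m1 := mono (show k + 2 ≤ l - 1 by omega)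
      have m2 := mono (show j + 2 ≤ l - 1 by omega)
      have := dbl (l - 1)
      rw [sub_add_cancel] at this
      linarith
  rw [LPF.blockS, mult, key, FourierTransform.fourierInv_zero]

end Blocks

/-! ### Products of two blocks -/

section BlockProduct

variable {V : Type*} [NormedAddCommGroup V] [InnerProductSpace ℝ V]
    [FiniteDimensional ℝ V] [MeasurableSpace V] [BorelSpace V]

/-- The two-sided geometric sum `∑_{k ∈ ℤ} 2^{-δ|k-m|}`. -/
def geom (δ : ℝ) : ℝ≥0∞ := ∑' k : ℤ, wt (-δ * |(k : ℝ)|)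

lemma geom_ne_top {δ : ℝ} (hδ : 0 < δ) : geom δ ≠ ∞ := by
  have hr : (2 : ℝ) ^ (-δ) < 1 := Real.rpow_lt_one_of_one_lt_of_neg one_lt_two (by linarith)
  have h0 : Summable fun n : ℕ => ((2 : ℝ) ^ (-δ)) ^ n :=
    summable_geometric_of_lt_one (by positivity) hr
  have h1 : Summable fun k : ℤ => (2 : ℝ) ^ (-δ * |(k : ℝ)|) := by
    refine Summable.of_nat_of_neg ?_ ?_ <;>
    · refine h0.congr fun n => ?_
      rw [← Real.rpow_natCast, ← Real.rpow_mul two_pos.le]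
      simp
  exact h1.tsum_ofReal_ne_top

lemma tsum_wt_sub (δ : ℝ) (m : ℤ) : ∑' k : ℤ, wt (-δ * |(k : ℝ) - m|) = geom δ := by
  rw [geom, ← (Equiv.subRight m).tsum_eq (fun k : ℤ => wt (-δ * |(k : ℝ)|))]
  simp

lemma eLpNorm_le_of_enorm_le {F H : V → ℂ} {M : ℝ≥0∞} (hM : M ≠ ∞)
    (h : ∀ x, ‖H x‖ₑ ≤ M * ‖F x‖ₑ) (q : ℝ≥0∞) :
    eLpNorm H q volume ≤ M * eLpNorm F q volume := by
  lift M to NNReal using hM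
  exact eLpNorm_le_nnreal_smul_eLpNorm_of_ae_le_mul' (Filter.Eventually.of_forall h) _

lemma eLpNorm_pmul_le (f g : 𝓢(V, ℂ)) {q : ℝ} (hq : 0 < q) :
    eLpNorm (pmul f g) (ENNReal.ofReal q) volume ≤
      eLpNorm f (ENNReal.ofReal (2 * q)) volume * eLpNorm g (ENNReal.ofReal (2 * q)) volume := by
  have : ENNReal.HolderTriple (ENNReal.ofReal (2 * q)) (ENNReal.ofReal (2 * q))
      (ENNReal.ofReal q) := ⟨by
    rw [← ENNReal.ofReal_inv_of_pos hq, ← ENNReal.ofReal_inv_of_pos (by positivity),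
      ← ENNReal.ofReal_add (by positivity) (by positivity)]
    congr 1
    field_simp
    norm_num⟩
  have e : ⇑(pmul f g) = ⇑f • ⇑g := rfl
  rw [e]
  exact eLpNorm_smul_le_mul_eLpNorm (hpqr := this) g.continuous.aestronglyMeasurable
    f.continuous.aestronglyMeasurable

lemma eLpNorm_schwartz_ne_top (f : 𝓢(V, ℂ)) (q : ℝ≥0∞) : eLpNorm f q volume ≠ ∞ :=
  (f.memLp q volume).eLpNorm_lt_top.ne

variable (χ : LPF V)

/-- Frequency-localized form of the product estimate, one output frequency at a time. -/
lemma LPF.wt_mul_eLpNorm_blockS_pmul_le {p : ℝ} (hp : 2 ≤ p)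
    (ha : 0 < Module.finrank ℝ V / p) (ha1 : Module.finrank ℝ V / p ≤ 1) :
    ∃ C : ℝ≥0∞, C ≠ ∞ ∧ ∀ (j k l : ℤ) (f g : 𝓢(V, ℂ)),
      wt ((Module.finrank ℝ V / p - 1) * k) *
          eLpNorm (χ.blockS k (pmul (χ.blockS j f) (χ.blockS l g))) (ENNReal.ofReal p) volume ≤
        C * wt (-(2 * (Module.finrank ℝ V / p) - 1) * |(k : ℝ) - (max j l : ℤ)|) *
          ((wt ((Module.finrank ℝ V / p - 1) * j) *
            eLpNorm (χ.blockS j f) (ENNReal.ofReal p) volume) *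
          (wt (Module.finrank ℝ V / p * l) *
            eLpNorm (χ.blockS l g) (ENNReal.ofReal p) volume)) := by
  set a := Module.finrank ℝ V / p with had
  obtain ⟨C₁, h₁, H₁⟩ := eLpNorm_mult_le χ.phi
  obtain ⟨C₂, h₂, H₂⟩ := χ.enorm_blockS_le (q := p) (by linarith)
  obtain ⟨C₃, h₃, H₃⟩ := eLpNorm_two_mul_mult_le χ.phi (q := p / 2) (by linarith)
  rw [← had] at H₂
  rw [show 2 * (p / 2) = p by ring, ← had] at H₃
  refine ⟨(C₁ * C₂ + C₃) * wt 6, ENNReal.mul_ne_top (ENNReal.add_ne_top.2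
    ⟨ENNReal.mul_ne_top h₁ h₂, h₃⟩) (wt_ne_top _), fun j k l f g => ?_⟩
  set F := χ.blockS j f
  set G := χ.blockS l g
  set X := eLpNorm F (ENNReal.ofReal p) volume with hX
  set Y := eLpNorm G (ENNReal.ofReal p) volume with hY
  set m := max j l with hm
  have fin : ∀ D : ℝ≥0∞, D ≤ C₁ * C₂ + C₃ → ∀ v : ℝ,
      v ≤ 6 + -(2 * a - 1) * |(k : ℝ) - m| + (a - 1) * j + a * l →
      D * wt v * (X * Y) ≤ (C₁ * C₂ + C₃) * wt 6 * wt (-(2 * a - 1) * |(k : ℝ) - m|) *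
        (wt ((a - 1) * j) * X * (wt (a * l) * Y)) := by
    intro D hD v hv
    calc D * wt v * (X * Y) ≤ (C₁ * C₂ + C₃) * wt (6 + -(2 * a - 1) * |(k : ℝ) - m| +
        (a - 1) * j + a * l) * (X * Y) := by gcongr; exact wt_mono hv
      _ = _ := by rw [wt_add, wt_add, wt_add]; ring
  by_cases hz : m + 3 ≤ k ∨ (l + 3 ≤ j ∧ k + 3 ≤ j) ∨ (j + 3 ≤ l ∧ k + 3 ≤ l)
  · rw [χ.blockS_pmul_eq_zero hz]
    have : eLpNorm (⇑(0 : 𝓢(V, ℂ))) (ENNReal.ofReal p) (volume : Measure V) = 0 := eLpNorm_zero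
    rw [this, mul_zero]
    exact zero_le
  push Not at hz
  obtain ⟨hk, hz1, hz2⟩ := hz
  have hkR : (k : ℝ) ≤ m + 2 := by exact_mod_cast (by omega : k ≤ m + 2)
  by_cases hA : l + 3 ≤ j
  · have hmj : m = j := max_eq_left (by omega)
    have hk2 := hz1 hA
    have hkj : (j : ℝ) - 2 ≤ k := by exact_mod_cast (by omega : j - 2 ≤ k)
    have hFG : eLpNorm (pmul F G) (ENNReal.ofReal p) volume ≤ C₂ * wt (l * a) * Y * X := by
      refine eLpNorm_le_of_enorm_le (ENNReal.mul_ne_top (ENNReal.mul_ne_top h₂ (wt_ne_top _))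
        (eLpNorm_schwartz_ne_top _ _)) (fun x => ?_) _
      rw [pmul_apply, enorm_mul, mul_comm]
      gcongr
      exact H₂ l g x
    calc _ ≤ wt ((a - 1) * k) * (C₁ * (C₂ * wt (l * a) * Y * X)) := by
          gcongr
          exact (H₁ k p (by linarith) _).trans (by gcongr)
      _ = C₁ * C₂ * wt ((a - 1) * k + l * a) * (X * Y) := by rw [wt_add]; ring
      _ ≤ _ := fin _ le_self_add _ (by
          rw [hmj] at hkR ⊢
          have : |(k : ℝ) - j| ≤ 2 := by rw [abs_le]; constructor <;> linarith
          have h0 := abs_nonneg ((k : ℝ) - j)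
          nlinarith)
  by_cases hB : j + 3 ≤ l
  · have hml : m = l := max_eq_right (by omega)
    have hk2 := hz2 hB
    have hkl : (l : ℝ) - 2 ≤ k := by exact_mod_cast (by omega : l - 2 ≤ k)
    have hjl : (j : ℝ) ≤ l := by exact_mod_cast (by omega : j ≤ l)
    have hFG : eLpNorm (pmul F G) (ENNReal.ofReal p) volume ≤ C₂ * wt (j * a) * X * Y := by
      refine eLpNorm_le_of_enorm_le (ENNReal.mul_ne_top (ENNReal.mul_ne_top h₂ (wt_ne_top _))
        (eLpNorm_schwartz_ne_top _ _)) (fun x => ?_) _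
      rw [pmul_apply, enorm_mul]
      gcongr
      exact H₂ j f x
    calc _ ≤ wt ((a - 1) * k) * (C₁ * (C₂ * wt (j * a) * X * Y)) := by
          gcongr
          exact (H₁ k p (by linarith) _).trans (by gcongr)
      _ = C₁ * C₂ * wt ((a - 1) * k + j * a) * (X * Y) := by rw [wt_add]; ring
      _ ≤ _ := fin _ le_self_add _ (by
          rw [hml] at hkR ⊢
          have : |(k : ℝ) - l| ≤ 2 := by rw [abs_le]; constructor <;> linarith
          have h0 := abs_nonneg ((k : ℝ) - l)
          nlinarith)
  have hj1 : (m : ℝ) ≤ j + 2 := by exact_mod_cast (by omega : m ≤ j + 2)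
  have hl1 : (m : ℝ) ≤ l + 2 := by exact_mod_cast (by omega : m ≤ l + 2)
  have hj2 : (j : ℝ) ≤ m := by exact_mod_cast (by omega : j ≤ m)
  have hl2 : (l : ℝ) ≤ m := by exact_mod_cast (by omega : l ≤ m)
  have hFG := eLpNorm_pmul_le F G (q := p / 2) (by linarith)
  rw [show 2 * (p / 2) = p by ring, ← hX, ← hY] at hFG
  calc _ ≤ wt ((a - 1) * k) * (C₃ * wt (k * a) * (X * Y)) := by
        gcongr
        exact (H₃ k _).trans (by gcongr)
    _ = C₃ * wt ((a - 1) * k + k * a) * (X * Y) := by rw [wt_add]; ring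
    _ ≤ _ := fin _ le_add_self _ (by
        rcases abs_cases ((k : ℝ) - m) with ⟨h, h'⟩ | ⟨h, h'⟩ <;> rw [h] <;> nlinarith)

/-- The Besov norm of the product of two blocks. -/
lemma LPF.tsum_blockS_pmul_blockS_le {p : ℝ} (hp : 2 ≤ p)
    (ha : 1 / 2 < Module.finrank ℝ V / p) (ha1 : Module.finrank ℝ V / p ≤ 1) :
    ∃ C : ℝ≥0∞, C ≠ ∞ ∧ ∀ (j l : ℤ) (f g : 𝓢(V, ℂ)),
      ∑' k : ℤ, wt ((Module.finrank ℝ V / p - 1) * k) *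
          eLpNorm (χ.blockS k (pmul (χ.blockS j f) (χ.blockS l g))) (ENNReal.ofReal p) volume ≤
        C * ((wt ((Module.finrank ℝ V / p - 1) * j) *
            eLpNorm (χ.blockS j f) (ENNReal.ofReal p) volume) *
          (wt (Module.finrank ℝ V / p * l) *
            eLpNorm (χ.blockS l g) (ENNReal.ofReal p) volume)) := by
  obtain ⟨C, hC, H⟩ := χ.wt_mul_eLpNorm_blockS_pmul_le hp (by linarith) ha1
  refine ⟨C * geom (2 * (Module.finrank ℝ V / p) - 1),
    ENNReal.mul_ne_top hC (geom_ne_top (by linarith)), fun j l f g => ?_⟩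
  refine (ENNReal.tsum_le_tsum fun k => H j k l f g).trans (le_of_eq ?_)
  rw [ENNReal.tsum_mul_right, ENNReal.tsum_mul_left, tsum_wt_sub]

end BlockProduct

/-! ### The product law for Schwartz functions -/

section ProductLaw

variable {V : Type*} [NormedAddCommGroup V] [InnerProductSpace ℝ V]
    [FiniteDimensional ℝ V] [MeasurableSpace V] [BorelSpace V]

variable (χ : LPF V)

lemma LPF.chi_le_one (x : V) : χ.chi x ≤ 1 := by
  rw [← χ.eq_one 0 (by simp)]
  exact χ.radial_antitone _ _ (by simp)

/-- The sum of the blocks with index in `[-n, n)`. -/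
def LPF.partialSum (n : ℕ) (f : 𝓢(V, ℂ)) : 𝓢(V, ℂ) :=
  ∑ i ∈ Finset.range (2 * n), χ.blockS ((i : ℤ) - n) f

lemma LPF.fourier_partialSum (n : ℕ) (f : 𝓢(V, ℂ)) (ξ : V) :
    𝓕 (χ.partialSum n f) ξ =
      ((χ.chi ((2 : ℝ) ^ (-(n : ℤ)) • ξ) - χ.chi ((2 : ℝ) ^ (n : ℤ) • ξ) : ℝ) : ℂ) * 𝓕 f ξ := by
  simp only [LPF.partialSum, FourierTransform.fourier_sum, LPF.blockS, fourier_mult]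
  rw [_root_.sum_apply]
  simp only [pmul_apply, dil_apply, ← Finset.sum_mul]
  congr 1
  have h : ∀ i : ℕ, χ.phi ((2 : ℝ) ^ (-((i : ℤ) - n)) • ξ) =
      ((χ.chi ((2 : ℝ) ^ (-(((i + 1 : ℕ) : ℤ) - n)) • ξ) : ℝ) : ℂ) -
        ((χ.chi ((2 : ℝ) ^ (-((i : ℤ) - n)) • ξ) : ℝ) : ℂ) := fun i => by
    rw [LPF.phi, bumpS_apply, LPF.phiHat, smul_smul, ← zpow_neg_one, ← zpow_add₀ two_ne_zero]
    push_cast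
    congr 5
    ring
  simp_rw [h]
  rw [Finset.sum_range_sub (fun i : ℕ => ((χ.chi ((2 : ℝ) ^ (-((i : ℤ) - n)) • ξ) : ℝ) : ℂ))]
  push_cast
  congr 5 <;> ring

lemma LPF.norm_symbol_le (n : ℤ) (m : ℤ) (ξ : V) :
    ‖((χ.chi ((2 : ℝ) ^ n • ξ) - χ.chi ((2 : ℝ) ^ m • ξ) : ℝ) : ℂ)‖ ≤ 1 := by
  rw [Complex.norm_real, Real.norm_eq_abs, abs_le]
  have h1 := χ.chi_le_one ((2 : ℝ) ^ n • ξ)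
  have h2 := χ.chi_le_one ((2 : ℝ) ^ m • ξ)
  have h3 := χ.nonneg ((2 : ℝ) ^ n • ξ)
  have h4 := χ.nonneg ((2 : ℝ) ^ m • ξ)
  constructor <;> linarith

lemma schwartz_eq_integral (f : 𝓢(V, ℂ)) (x : V) :
    f x = ∫ ξ, Real.fourierChar (inner ℝ ξ x) • 𝓕 f ξ := by
  have h : 𝓕⁻ (𝓕 f) = f := FourierTransform.fourierInv_fourier_eq f
  conv_lhs => rw [← h]
  rw [SchwartzMap.fourierInv_coe, Real.fourierInv_eq]

lemma LPF.norm_partialSum_le (n : ℕ) (f : 𝓢(V, ℂ)) (x : V) :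
    ‖χ.partialSum n f x‖ ≤ ∫ ξ, ‖𝓕 f ξ‖ := by
  rw [schwartz_eq_integral]
  refine norm_integral_le_of_norm_le (𝓕 f).integrable.norm (Filter.Eventually.of_forall fun ξ => ?_)
  rw [Circle.norm_smul, χ.fourier_partialSum, norm_mul]
  exact mul_le_of_le_one_left (norm_nonneg _) (χ.norm_symbol_le _ _ _)

lemma LPF.tendsto_partialSum [Nontrivial V] (f : 𝓢(V, ℂ)) (x : V) :
    Filter.Tendsto (fun n => χ.partialSum n f x) Filter.atTop (nhds (f x)) := by
  rw [schwartz_eq_integral f]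
  simp_rw [schwartz_eq_integral (χ.partialSum _ f)]
  refine tendsto_integral_of_dominated_convergence (fun ξ => ‖𝓕 f ξ‖) (fun n => ?_)
    (𝓕 f).integrable.norm (fun n => Filter.Eventually.of_forall fun ξ => ?_) ?_
  · have : Continuous fun ξ => Real.fourierChar (inner ℝ ξ x) • 𝓕 (χ.partialSum n f) ξ :=
      (Real.continuous_fourierChar.comp (continuous_id.inner continuous_const)).smul
        (𝓕 (χ.partialSum n f)).continuous
    exact this.aestronglyMeasurable
  · rw [Circle.norm_smul, χ.fourier_partialSum, norm_mul]
    exact mul_le_of_le_one_left (norm_nonneg _) (χ.norm_symbol_le _ _ _)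
  · have h0 : ∀ᵐ ξ : V, ξ ≠ 0 := by
      rw [ae_iff]; simp
    filter_upwards [h0] with ξ hξ
    refine Filter.Tendsto.congr' ?_ tendsto_const_nhds
    have hpos := norm_pos_iff.2 hξ
    filter_upwards [(tendsto_pow_atTop_atTop_of_one_lt (one_lt_two (α := ℝ))).eventually_ge_atTop
      ‖ξ‖, (tendsto_pow_atTop_atTop_of_one_lt (one_lt_two (α := ℝ))).eventually_ge_atTop
      (2 / ‖ξ‖)] with n hn1 hn2
    rw [χ.fourier_partialSum, χ.chi_smul_eq_one (by positivity) (by simpa using hn1),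
      χ.chi_smul_eq_zero (by positivity)]
    · simp
    · rw [zpow_natCast]
      rw [div_le_iff₀ hpos] at hn2
      rw [div_le_iff₀ (by positivity)]
      linarith

lemma mult_sum {ι : Type*} (s : Finset ι) (m : 𝓢(V, ℂ)) (f : ι → 𝓢(V, ℂ)) :
    mult m (∑ i ∈ s, f i) = ∑ i ∈ s, mult m (f i) := by
  simp only [mult, FourierTransform.fourier_sum, pmul, map_sum, FourierTransform.fourierInv_sum]

lemma pmul_sum_sum {ι κ : Type*} (s : Finset ι) (t : Finset κ) (f : ι → 𝓢(V, ℂ))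
    (g : κ → 𝓢(V, ℂ)) :
    pmul (∑ i ∈ s, f i) (∑ j ∈ t, g j) = ∑ i ∈ s, ∑ j ∈ t, pmul (f i) (g j) := by
  ext x
  simp only [pmul_apply, _root_.sum_apply, Finset.sum_mul_sum]

lemma sum_range_shift_le_tsum (n : ℕ) (F : ℤ → ℝ≥0∞) :
    ∑ i ∈ Finset.range (2 * n), F ((i : ℤ) - n) ≤ ∑' j, F j := by
  have hinj : Function.Injective (fun i : ℕ => (i : ℤ) - n) := fun i j h => by
    simpa using h
  exact (Finset.sum_map (Finset.range (2 * n)) ⟨_, hinj⟩ F).symm.trans_le (ENNReal.sum_le_tsum _)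

lemma LPF.tendsto_blockS_partialSum [Nontrivial V] (k : ℤ) (f g : 𝓢(V, ℂ)) (x : V) :
    Filter.Tendsto (fun n => χ.blockS k (pmul (χ.partialSum n f) (χ.partialSum n g)) x)
      Filter.atTop (nhds (χ.blockS k (pmul f g) x)) := by
  simp only [LPF.blockS, mult_eq_convolution, convolution, ContinuousLinearMap.mul_apply',
    pmul_apply]
  set K : 𝓢(V, ℂ) := 𝓕⁻ (dil k χ.phi)
  refine tendsto_integral_of_dominated_convergence
    (fun t => ‖K t‖ * ((∫ ξ, ‖𝓕 f ξ‖) * ∫ ξ, ‖𝓕 g ξ‖)) (fun n => ?_)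
    (K.integrable.norm.mul_const _) (fun n => Filter.Eventually.of_forall fun t => ?_)
    (Filter.Eventually.of_forall fun t => ?_)
  · refine Continuous.aestronglyMeasurable ?_
    have h1 := (χ.partialSum n f).continuous
    have h2 := (χ.partialSum n g).continuous
    have h3 := K.continuous
    fun_prop
  · rw [norm_mul, norm_mul]
    gcongr
    · exact χ.norm_partialSum_le _ _ _
    · exact χ.norm_partialSum_le _ _ _
  · exact ((χ.tendsto_partialSum f _).mul (χ.tendsto_partialSum g _)).const_mul _

lemma LPF.eLpNorm_blockS_pmul_le_tsum [Nontrivial V] (k : ℤ) (f g : 𝓢(V, ℂ)) {p : ℝ≥0∞}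
    (hp : 1 ≤ p) :
    eLpNorm (χ.blockS k (pmul f g)) p volume ≤
      ∑' j : ℤ, ∑' l : ℤ,
        eLpNorm (χ.blockS k (pmul (χ.blockS j f) (χ.blockS l g))) p volume := by
  refine (Lp.eLpNorm_lim_le_liminf_eLpNorm
    (fun n =>
      (χ.blockS k (pmul (χ.partialSum n f) (χ.partialSum n g))).continuous.aestronglyMeasurable)
    _ (Filter.Eventually.of_forall (χ.tendsto_blockS_partialSum k f g))).trans ?_
  refine Filter.liminf_le_of_le (by isBoundedDefault) fun b hb => ?_
  obtain ⟨n, hn⟩ := hb.exists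
  refine hn.trans ?_
  rw [LPF.partialSum, LPF.partialSum, pmul_sum_sum, LPF.blockS, mult_sum]
  simp_rw [mult_sum]
  rw [coeS_sum]
  refine (eLpNorm_sum_le (fun i _ => (SchwartzMap.continuous _).aestronglyMeasurable) hp).trans ?_
  refine le_trans (Finset.sum_le_sum fun i _ => ?_) (sum_range_shift_le_tsum n _)
  rw [coeS_sum]
  refine (eLpNorm_sum_le (fun i _ => (SchwartzMap.continuous _).aestronglyMeasurable) hp).trans ?_
  exact sum_range_shift_le_tsum n
    (fun l => eLpNorm (χ.blockS k (pmul (χ.blockS (i - n) f) (χ.blockS l g))) p volume)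

lemma LPF.besov_coe (s p : ℝ) (f : 𝓢(V, ℂ)) :
    besov χ s p f = ∑' k : ℤ, wt (s * k) * eLpNorm (χ.blockS k f) (ENNReal.ofReal p) volume := by
  simp only [besov, wt, LPF.coe_blockS]

/-- **Product law** in the critical homogeneous Besov spaces. -/
theorem LPF.besov_pmul_le {ι : Type*} [Fintype ι] (b : OrthonormalBasis ι ℝ V) {p : ℝ}
    (hp : 2 ≤ p) (ha : 1 / 2 < Module.finrank ℝ V / p) (ha1 : Module.finrank ℝ V / p ≤ 1) :
    ∃ C : ℝ≥0∞, C ≠ ∞ ∧ ∀ f g : 𝓢(V, ℂ),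
      besov χ (Module.finrank ℝ V / p - 1) p (pmul f g) ≤
        C * (∑ i, besov χ (Module.finrank ℝ V / p - 1) p (∂_{b i} g : 𝓢(V, ℂ))) *
          besov χ (Module.finrank ℝ V / p - 1) p f := by
  have hp1 : 1 ≤ p := by linarith
  have hd : 0 < Module.finrank ℝ V := by
    by_contra! h
    norm_num [Nat.le_zero.1 h] at ha
  have : Nontrivial V := Module.nontrivial_of_finrank_pos hd
  obtain ⟨C₁, h₁, H₁⟩ := χ.tsum_blockS_pmul_blockS_le hp ha ha1
  obtain ⟨C₂, h₂, H₂⟩ := χ.wt_mul_eLpNorm_blockS_le b hp1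
  refine ⟨C₁ * C₂, ENNReal.mul_ne_top h₁ h₂, fun f g => ?_⟩
  set a := Module.finrank ℝ V / p
  have hg : ∀ l : ℤ, wt (a * l) * eLpNorm (χ.blockS l g) (ENNReal.ofReal p) volume ≤
      C₂ * ∑ i, wt ((a - 1) * l) *
        eLpNorm (χ.blockS l (∂_{b i} g)) (ENNReal.ofReal p) volume := fun l => by
    rw [← Finset.mul_sum, show a * (l : ℝ) = (a - 1) * l + l by ring, wt_add, mul_assoc,
      mul_left_comm C₂]
    exact mul_le_mul_right (H₂ l g) _
  calc besov χ (a - 1) p (pmul f g)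
      ≤ ∑' k : ℤ, ∑' j : ℤ, ∑' l : ℤ, wt ((a - 1) * k) *
          eLpNorm (χ.blockS k (pmul (χ.blockS j f) (χ.blockS l g))) (ENNReal.ofReal p) volume := by
        rw [χ.besov_coe]
        refine ENNReal.tsum_le_tsum fun k => ?_
        simp_rw [ENNReal.tsum_mul_left]
        gcongr
        exact χ.eLpNorm_blockS_pmul_le_tsum k f g (by simpa using hp1)
    _ = ∑' j : ℤ, ∑' l : ℤ, ∑' k : ℤ, wt ((a - 1) * k) *
          eLpNorm (χ.blockS k (pmul (χ.blockS j f) (χ.blockS l g))) (ENNReal.ofReal p) volume := by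
        rw [ENNReal.tsum_comm]
        exact tsum_congr fun j => ENNReal.tsum_comm
    _ ≤ ∑' j : ℤ, ∑' l : ℤ, C₁ * ((wt ((a - 1) * j) *
            eLpNorm (χ.blockS j f) (ENNReal.ofReal p) volume) * (C₂ * ∑ i, wt ((a - 1) * l) *
        eLpNorm (χ.blockS l (∂_{b i} g)) (ENNReal.ofReal p) volume)) := by
        refine ENNReal.tsum_le_tsum fun j => ENNReal.tsum_le_tsum fun l => (H₁ j l f g).trans ?_
        exact mul_le_mul_right (mul_le_mul_right (hg l) _) _
    _ = _ := by
        simp_rw [ENNReal.tsum_mul_left, ENNReal.tsum_mul_right, χ.besov_coe]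
        rw [Summable.tsum_finsetSum fun _ _ => ENNReal.summable]
        ring

end ProductLaw

/-! ### Polynomial nonlinearities -/

section Polynomial

variable {V : Type*} [NormedAddCommGroup V] [InnerProductSpace ℝ V]
    [FiniteDimensional ℝ V] [MeasurableSpace V] [BorelSpace V]

variable (χ : LPF V)

lemma LPF.besov_smul (s p : ℝ) (c : ℂ) (f : 𝓢(V, ℂ)) :
    besov χ s p (⇑(c • f)) = ‖c‖ₑ * besov χ s p f := by
  rw [χ.besov_coe, χ.besov_coe]
  simp only [LPF.blockS, mult_smul, coeS_smul, eLpNorm_const_smul]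
  rw [← ENNReal.tsum_mul_left]
  exact tsum_congr fun k => by ring

lemma LPF.besov_sum_le {ι : Type*} (t : Finset ι) (s : ℝ) {p : ℝ} (hp : 1 ≤ p)
    (f : ι → 𝓢(V, ℂ)) : besov χ s p (⇑(∑ i ∈ t, f i)) ≤ ∑ i ∈ t, besov χ s p (f i) := by
  rw [χ.besov_coe]
  simp only [χ.besov_coe, LPF.blockS, mult_sum, coeS_sum]
  rw [← Summable.tsum_finsetSum fun _ _ => ENNReal.summable]
  refine ENNReal.tsum_le_tsum fun k => ?_
  rw [← Finset.mul_sum]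
  gcongr
  exact eLpNorm_sum_le (fun i _ => (SchwartzMap.continuous _).aestronglyMeasurable)
    (by simpa using hp)

lemma LPF.besov_add_le (s : ℝ) {p : ℝ} (hp : 1 ≤ p) (f g : 𝓢(V, ℂ)) :
    besov χ s p (⇑(f + g)) ≤ besov χ s p f + besov χ s p g := by
  simpa using χ.besov_sum_le Finset.univ s hp ![f, g]

/-- The Besov norm of the gradient with respect to an orthonormal basis. -/
def LPF.gradBesov {ι : Type*} [Fintype ι] (b : OrthonormalBasis ι ℝ V) (s p : ℝ)
    (g : 𝓢(V, ℂ)) : ℝ≥0∞ :=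
  ∑ i, besov χ s p (∂_{b i} g : 𝓢(V, ℂ))

lemma LPF.gradBesov_zero {ι : Type*} [Fintype ι] (b : OrthonormalBasis ι ℝ V) (s p : ℝ) :
    χ.gradBesov b s p 0 = 0 := by
  have h : ∀ i, (∂_{b i} (0 : 𝓢(V, ℂ)) : 𝓢(V, ℂ)) = (0 : ℂ) • 0 := fun i => by
    rw [LineDeriv.lineDerivOp_zero, smul_zero]
  simp only [LPF.gradBesov, h, χ.besov_smul]
  simp

section ProductBound

variable {ι : Type*} [Fintype ι] {b : OrthonormalBasis ι ℝ V} {s p : ℝ} {C : ℝ≥0∞}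

lemma LPF.exists_prod_mul (hp : 1 ≤ p) (hC : ∀ f g : 𝓢(V, ℂ),
      besov χ s p (pmul f g) ≤ C * χ.gradBesov b s p g * besov χ s p f)
    {κ : Type*} (t : Finset κ) (c : κ → ℂ) (g : κ → 𝓢(V, ℂ)) (f : 𝓢(V, ℂ)) :
    ∃ F : 𝓢(V, ℂ), (∀ x, F x = (∏ k ∈ t, (c k + g k x)) * f x) ∧
      besov χ s p F ≤ (∏ k ∈ t, (‖c k‖ₑ + C * χ.gradBesov b s p (g k))) * besov χ s p f := by
  classical
  induction t using Finset.induction_on with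
  | empty => exact ⟨f, by simp, by simp⟩
  | insert k t hk ih =>
    obtain ⟨F, hF, hFb⟩ := ih
    refine ⟨c k • F + pmul F (g k), fun x => ?_, ?_⟩
    · rw [add_apply, smul_apply, pmul_apply, hF, Finset.prod_insert hk, smul_eq_mul]
      ring
    · rw [Finset.prod_insert hk, mul_assoc]
      refine (χ.besov_add_le s hp _ _).trans ?_
      rw [χ.besov_smul]
      refine (add_le_add_right (hC F (g k)) _).trans ?_
      rw [← add_mul]
      gcongr

lemma LPF.exists_adjugate_mul (hp : 1 ≤ p) (hC : ∀ f g : 𝓢(V, ℂ),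
      besov χ s p (pmul f g) ≤ C * χ.gradBesov b s p g * besov χ s p f)
    {n : ℕ} (M : V → Matrix (Fin n) (Fin n) ℝ) (g : Fin n → Fin n → 𝓢(V, ℂ))
    (hM : ∀ m l x, g m l x = (M x m l : ℂ)) {E : ℝ≥0∞}
    (hE : ∀ m l, χ.gradBesov b s p (g m l) ≤ E) (i j : Fin n) (f : 𝓢(V, ℂ)) :
    ∃ F : 𝓢(V, ℂ), (∀ x, F x = ((Matrix.adjugate (1 + M x) i j : ℝ) : ℂ) * f x) ∧
      besov χ s p F ≤ n.factorial * (1 + C * E) ^ (n - 1) * besov χ s p f := by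
  classical
  let c : Equiv.Perm (Fin n) → Fin n → ℂ := fun σ k =>
    if σ k = j then (Pi.single i (1 : ℂ) : Fin n → ℂ) k else (1 : Matrix (Fin n) (Fin n) ℂ) (σ k) k
  let g' : Equiv.Perm (Fin n) → Fin n → 𝓢(V, ℂ) := fun σ k => if σ k = j then 0 else g (σ k) k
  choose F hF hFb using fun σ => χ.exists_prod_mul hp hC Finset.univ (c σ) (g' σ) f
  refine ⟨∑ σ, ((Equiv.Perm.sign σ : ℤ) : ℂ) • F σ, fun x => ?_, ?_⟩
  · rw [_root_.sum_apply, Matrix.adjugate_apply, Matrix.det_apply']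
    push_cast
    rw [Finset.sum_mul]
    refine Finset.sum_congr rfl fun σ _ => ?_
    rw [Pi.smul_apply, hF, smul_eq_mul, ← mul_assoc]
    congr 2
    refine Finset.prod_congr rfl fun k _ => ?_
    by_cases h : σ k = j
    · simp only [c, g', h, if_true, Matrix.updateRow_self]
      rw [show (0 : 𝓢(V, ℂ)) x = 0 from rfl, add_zero]
      by_cases hk : k = i
      · subst hk; simp
      · simp [hk]
    · simp only [c, g', h, if_false, Matrix.updateRow_ne h, hM, Matrix.add_apply]
      rw [Matrix.one_apply, Matrix.one_apply]
      split_ifs <;> simp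
  · refine (χ.besov_sum_le _ s hp _).trans ?_
    have hc : ∀ σ k, ‖c σ k‖ₑ ≤ 1 := fun σ k => by
      have : ‖c σ k‖ ≤ 1 := by
        simp only [c, Pi.single_apply, Matrix.one_apply]
        split_ifs <;> simp
      rw [← ofReal_norm]
      exact ENNReal.ofReal_le_one.2 this
    have hterm : ∀ σ : Equiv.Perm (Fin n),
        besov χ s p (⇑(((Equiv.Perm.sign σ : ℤ) : ℂ) • F σ)) ≤
          (1 + C * E) ^ (n - 1) * besov χ s p f := fun σ => by
      have hs : ‖((Equiv.Perm.sign σ : ℤ) : ℂ)‖ₑ = 1 := by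
        rcases Int.units_eq_one_or (Equiv.Perm.sign σ) with h | h <;> simp [h]
      rw [χ.besov_smul, hs, one_mul]
      refine (hFb σ).trans ?_
      gcongr
      rw [← Finset.mul_prod_erase Finset.univ _ (Finset.mem_univ (σ⁻¹ j))]
      have h1 : ‖c σ (σ⁻¹ j)‖ₑ + C * χ.gradBesov b s p (g' σ (σ⁻¹ j)) ≤ 1 := by
        have : g' σ (σ⁻¹ j) = 0 := by simp [g']
        rw [this, χ.gradBesov_zero, mul_zero, add_zero]
        exact hc _ _
      refine (mul_le_of_le_one_left zero_le h1).trans ?_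
      refine (Finset.prod_le_pow_card _ _ (1 + C * E) fun k _ => ?_).trans_eq ?_
      · refine add_le_add (hc _ _) (mul_le_mul_right ?_ _)
        simp only [g']
        split_ifs
        · rw [χ.gradBesov_zero]; exact zero_le
        · exact hE _ _
      · rw [Finset.card_erase_of_mem (Finset.mem_univ _), Finset.card_univ, Fintype.card_fin]
    refine (Finset.sum_le_sum fun σ _ => hterm σ).trans_eq ?_
    rw [Finset.sum_const, Finset.card_univ, Fintype.card_perm, Fintype.card_fin, nsmul_eq_mul,
      mul_assoc]

lemma one_add_mul_pow_le (C E : ℝ≥0∞) (n : ℕ) (hn : 1 ≤ n) :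
    (1 + C * E) ^ n ≤ (1 + C) ^ n * (1 + ∑ r ∈ Finset.Icc 1 n, E ^ r) := by
  have h1 : 1 + C * E ≤ (1 + C) * max 1 E := by
    rw [add_mul, one_mul]
    exact add_le_add (le_max_left _ _) (mul_le_mul_right (le_max_right _ _) _)
  refine (pow_le_pow_left' h1 n).trans ?_
  rw [mul_pow]
  gcongr
  rcases le_total E 1 with h | h
  · rw [max_eq_left h, one_pow]; exact le_self_add
  · rw [max_eq_right h]
    exact (Finset.single_le_sum (f := fun r => E ^ r) (fun _ _ => zero_le)
      (Finset.mem_Icc.2 ⟨hn, le_rfl⟩)).trans le_add_self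

end ProductBound

end Polynomial

/-! ### Time-dependent test functions -/

section Minkowski

variable {α β : Type*} [MeasurableSpace α] [MeasurableSpace β]

/-- Minkowski's integral inequality, for a function with finite `L^p` norm. -/
lemma lintegral_rpow_le_of_le_lintegral {μ : Measure α} {ν : Measure β} [SFinite μ] [SFinite ν]
    {G : α → ℝ≥0∞} {h : β → α → ℝ≥0∞} (hG : Measurable G)
    (hh : Measurable (Function.uncurry h)) (hle : ∀ x, G x ≤ ∫⁻ τ, h τ x ∂ν) {p : ℝ} (hp : 1 < p)
    (hfin : ∫⁻ x, G x ^ p ∂μ ≠ ∞) :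
    (∫⁻ x, G x ^ p ∂μ) ^ (1 / p) ≤ ∫⁻ τ, (∫⁻ x, h τ x ^ p ∂μ) ^ (1 / p) ∂ν := by
  have hp0 : 0 < p := by linarith
  set I := ∫⁻ x, G x ^ p ∂μ with hI
  set S := ∫⁻ τ, (∫⁻ x, h τ x ^ p ∂μ) ^ (1 / p) ∂ν
  by_cases h0 : I = 0
  · rw [h0, ENNReal.zero_rpow_of_pos (by positivity)]
    exact zero_le
  have hpq : p.HolderConjugate (p / (p - 1)) := Real.HolderConjugate.conjExponent hp
  have hpow : ∀ a : ℝ≥0∞, (a ^ (p - 1)) ^ (p / (p - 1)) = a ^ p := fun a => by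
    rw [← ENNReal.rpow_mul, mul_div_cancel₀ _ (by linarith : p - 1 ≠ 0)]
  have hmeas : Measurable fun z : α × β => h z.2 z.1 := hh.comp measurable_swap
  have key : I ≤ I ^ (1 - 1 / p) * S := by
    calc I ≤ ∫⁻ x, ∫⁻ τ, G x ^ (p - 1) * h τ x ∂ν ∂μ := by
          refine lintegral_mono fun x => ?_
          have hx : Measurable fun τ => h τ x := hmeas.comp measurable_prodMk_left
          rw [lintegral_const_mul _ hx]
          calc G x ^ p = G x ^ ((p - 1) + 1) := by rw [sub_add_cancel]
            _ = G x ^ (p - 1) * G x := by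
                rw [ENNReal.rpow_add_of_nonneg _ _ (by linarith) zero_le_one, ENNReal.rpow_one]
            _ ≤ _ := mul_le_mul_right (hle x) _
      _ = ∫⁻ τ, ∫⁻ x, G x ^ (p - 1) * h τ x ∂μ ∂ν :=
          lintegral_lintegral_swap
            (((hG.comp measurable_fst).pow_const _).mul hmeas).aemeasurable
      _ ≤ ∫⁻ τ, I ^ (1 - 1 / p) * (∫⁻ x, h τ x ^ p ∂μ) ^ (1 / p) ∂ν := by
          refine lintegral_mono fun τ => ?_
          have hτ : Measurable (h τ) := hh.comp measurable_prodMk_left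
          refine (ENNReal.lintegral_mul_le_Lp_mul_Lq μ hpq.symm (hG.pow_const _).aemeasurable
            hτ.aemeasurable).trans_eq ?_
          simp only [hpow]
          congr 2
          field_simp
      _ = _ := by
          refine lintegral_const_mul _ ?_
          exact (Measurable.lintegral_prod_right' (hh.pow_const p)).pow_const _
  have hsplit : I = I ^ (1 - 1 / p) * I ^ (1 / p) := by
    rw [← ENNReal.rpow_add _ _ h0 hfin, sub_add_cancel, ENNReal.rpow_one]
  have hn0 : I ^ (1 - 1 / p) ≠ 0 := by simp [h0, hfin]
  have hnt : I ^ (1 - 1 / p) ≠ ∞ := by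
    refine ENNReal.rpow_ne_top_of_nonneg ?_ hfin
    rw [sub_nonneg, div_le_one hp0]; exact hp.le
  conv_lhs at key => rw [hsplit]
  exact (ENNReal.mul_le_mul_iff_right hn0 hnt).1 key

end Minkowski

section Test

variable {V : Type*} [NormedAddCommGroup V] [InnerProductSpace ℝ V]
    [FiniteDimensional ℝ V] [MeasurableSpace V] [BorelSpace V]

/-- Smooth compactly supported functions of time and space. -/
structure IsTest {W : Type*} [NormedAddCommGroup W] [NormedSpace ℝ W] (F : ℝ → V → W) : Prop where
  contDiff : ContDiff ℝ (⊤ : ℕ∞) (Function.uncurry F)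
  hasCompactSupport : HasCompactSupport (Function.uncurry F)

namespace IsTest

variable {W : Type*} [NormedAddCommGroup W] [NormedSpace ℝ W]

lemma clm_comp {W' : Type*} [NormedAddCommGroup W'] [NormedSpace ℝ W'] {F : ℝ → V → W}
    (hF : IsTest F) (L : W →L[ℝ] W') : IsTest fun t y => L (F t y) :=
  ⟨L.contDiff.comp hF.contDiff, hF.hasCompactSupport.comp_left L.map_zero⟩

lemma fderiv_apply {F : ℝ → V → W} (hF : IsTest F) (v : ℝ × V) :
    IsTest fun t y => fderiv ℝ (Function.uncurry F) (t, y) v :=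
  ⟨(hF.contDiff.fderiv_right (m := (⊤ : ℕ∞)) (by simp)).clm_apply contDiff_const,
    hF.hasCompactSupport.fderiv_apply ℝ v⟩

lemma contDiff_slice {F : ℝ → V → W} (hF : IsTest F) (t : ℝ) : ContDiff ℝ (⊤ : ℕ∞) (F t) :=
  hF.contDiff.comp (contDiff_prodMk_right t)

lemma exists_compact {F : ℝ → V → W} (hF : IsTest F) :
    ∃ k : Set ℝ, IsCompact k ∧ ∃ K : Set V, IsCompact K ∧
      (∀ t y, t ∉ k → F t y = 0) ∧ ∀ t y, y ∉ K → F t y = 0 := by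
  refine ⟨_, hF.hasCompactSupport.isCompact.image continuous_fst, _,
    hF.hasCompactSupport.isCompact.image continuous_snd, fun t y h => ?_, fun t y h => ?_⟩
  · by_contra hne
    exact h ⟨(t, y), subset_tsupport _ hne, rfl⟩
  · by_contra hne
    exact h ⟨(t, y), subset_tsupport _ hne, rfl⟩

lemma hasCompactSupport_slice {F : ℝ → V → W} (hF : IsTest F) (t : ℝ) :
    HasCompactSupport (F t) := by
  obtain ⟨-, -, K, hK, -, h⟩ := hF.exists_compact
  exact HasCompactSupport.intro hK fun y hy => h t y hy

lemma fderiv_slice {F : ℝ → V → W} (hF : IsTest F) (t : ℝ) (y e : V) :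
    fderiv ℝ (F t) y e = fderiv ℝ (Function.uncurry F) (t, y) (0, e) := by
  have h1 : HasFDerivAt (Function.uncurry F) (fderiv ℝ (Function.uncurry F) (t, y)) (t, y) :=
    (hF.contDiff.differentiable (by simp) _).hasFDerivAt
  have h2 := h1.comp y (hasFDerivAt_prodMk_right t y)
  rw [show F t = Function.uncurry F ∘ fun y => (t, y) from rfl, h2.fderiv]
  simp

lemma hasDerivAt_time {F : ℝ → V → W} (hF : IsTest F) (t : ℝ) (y : V) :
    HasDerivAt (fun τ => F τ y) (fderiv ℝ (Function.uncurry F) (t, y) (1, 0)) t := by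
  have h1 : HasFDerivAt (Function.uncurry F) (fderiv ℝ (Function.uncurry F) (t, y)) (t, y) :=
    (hF.contDiff.differentiable (by simp) _).hasFDerivAt
  exact h1.comp_hasDerivAt t ((hasDerivAt_id t).prodMk (hasDerivAt_const t y))

variable {F : ℝ → V → ℂ}

/-- The restriction of a test function to a fixed time, as a Schwartz function. -/
def slice (hF : IsTest F) (t : ℝ) : 𝓢(V, ℂ) :=
  (hF.hasCompactSupport_slice t).toSchwartzMap (hF.contDiff_slice t)

@[simp] lemma slice_apply (hF : IsTest F) (t : ℝ) (y : V) : hF.slice t y = F t y := rfl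

lemma coe_slice (hF : IsTest F) (t : ℝ) : ⇑(hF.slice t) = F t := rfl

lemma lineDeriv_slice (hF : IsTest F) (t : ℝ) (e : V) :
    (∂_{e} (hF.slice t) : 𝓢(V, ℂ)) = (hF.fderiv_apply (0, e)).slice t := by
  ext y
  rw [SchwartzMap.lineDerivOp_apply_eq_fderiv, coe_slice, hF.fderiv_slice, slice_apply]

lemma continuous_slice_time (hF : IsTest F) (y : V) : Continuous fun τ => F τ y :=
  hF.contDiff.continuous.comp (Continuous.prodMk_left y)

lemma contDiff_timeIntegral (hF : IsTest F) (t : ℝ) :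
    ContDiff ℝ (⊤ : ℕ∞) fun y => ∫ τ in Set.Ioc 0 t, F τ y := by
  obtain ⟨k, hk, -, -, h, -⟩ := hF.exists_compact
  have hf : LocallyIntegrable ((Set.Ioc 0 t).indicator fun _ => (1 : ℝ)) volume :=
    ((integrable_indicator_iff measurableSet_Ioc).2
      (integrableOn_const (by simp))).locallyIntegrable
  have := contDiffOn_convolution_right_with_param_comp (n := (⊤ : ℕ∞)) (μ := volume)
    (ContinuousLinearMap.lsmul ℝ ℝ : ℝ →L[ℝ] ℂ →L[ℝ] ℂ) (s := Set.univ)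
    (v := fun _ : V => (0 : ℝ)) contDiffOn_const (g := fun y τ => F (-τ) y) (k := -k)
    isOpen_univ hk.neg (fun y τ _ hτ => h _ _ (by simpa using hτ)) hf
    (hF.contDiff.comp ((contDiff_snd.neg).prodMk contDiff_fst)).contDiffOn
  rw [contDiffOn_univ] at this
  convert this using 2 with y
  rw [convolution, ← integral_indicator measurableSet_Ioc]
  congr 1 with τ
  by_cases hτ : τ ∈ Set.Ioc 0 t <;> simp [hτ]

lemma hasCompactSupport_timeIntegral (hF : IsTest F) (t : ℝ) :
    HasCompactSupport fun y => ∫ τ in Set.Ioc 0 t, F τ y := by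
  obtain ⟨-, -, K, hK, -, h⟩ := hF.exists_compact
  exact HasCompactSupport.intro hK fun y hy => by simp [h _ y hy]

/-- The time integral `∫₀ᵗ F(τ) dτ`, as a Schwartz function. -/
def timeIntegral (hF : IsTest F) (t : ℝ) : 𝓢(V, ℂ) :=
  (hF.hasCompactSupport_timeIntegral t).toSchwartzMap (hF.contDiff_timeIntegral t)

lemma timeIntegral_apply (hF : IsTest F) (t : ℝ) (y : V) :
    hF.timeIntegral t y = ∫ τ in Set.Ioc 0 t, F τ y := rfl

lemma lineDeriv_timeIntegral (hF : IsTest F) (t : ℝ) (e : V) :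
    (∂_{e} (hF.timeIntegral t) : 𝓢(V, ℂ)) = (hF.fderiv_apply (0, e)).timeIntegral t := by
  ext y
  rw [SchwartzMap.lineDerivOp_apply]
  have hF' := hF.fderiv_apply (0, e)
  obtain ⟨M, hM⟩ := hF'.hasCompactSupport.exists_bound_of_continuous hF'.contDiff.continuous
  have hd : ∀ τ s, HasDerivAt (fun s : ℝ => F τ (y + s • e))
      (fderiv ℝ (Function.uncurry F) (τ, y + s • e) (0, e)) s := fun τ s => by
    have h1 : HasFDerivAt (F τ) (fderiv ℝ (F τ) (y + s • e)) (y + s • e) :=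
      ((hF.contDiff_slice τ).differentiable (by simp) _).hasFDerivAt
    rw [← hF.fderiv_slice]
    have h2 : HasDerivAt (fun s : ℝ => y + s • e) e s := by
      simpa using ((hasDerivAt_id s).smul_const e).const_add y
    exact h1.comp_hasDerivAt s h2
  have := hasDerivAt_integral_of_dominated_loc_of_deriv_le (μ := volume.restrict (Set.Ioc 0 t))
    (F := fun (s : ℝ) τ => F τ (y + s • e))
    (F' := fun s τ => fderiv ℝ (Function.uncurry F) (τ, y + s • e) (0, e)) (x₀ := 0)
    (bound := fun _ => M) Filter.univ_mem
    (Filter.Eventually.of_forall fun s =>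
      (hF.continuous_slice_time (y + s • e)).aestronglyMeasurable)
    ((hF.continuous_slice_time (y + (0 : ℝ) • e)).integrableOn_Ioc)
    (hF'.continuous_slice_time (y + (0 : ℝ) • e)).aestronglyMeasurable
    (Filter.Eventually.of_forall fun τ s _ => hM (τ, y + s • e))
    (integrableOn_const (by simp))
    (Filter.Eventually.of_forall fun τ s _ => hd τ s)
  have h2 := this.2.deriv
  simp only [zero_smul, add_zero] at h2
  exact h2

variable (χ : LPF V)

lemma blockS_slice_eq (hF : IsTest F) (k : ℤ) (t : ℝ) (x : V) :
    χ.blockS k (hF.slice t) x = ∫ y, (𝓕⁻ (dil k χ.phi) : 𝓢(V, ℂ)) y * F t (x - y) := by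
  rw [LPF.blockS, mult_eq_convolution]
  rfl

lemma measurable_blockS_slice (hF : IsTest F) (k : ℤ) :
    Measurable fun z : ℝ × V => χ.blockS k (hF.slice z.1) z.2 := by
  simp_rw [hF.blockS_slice_eq χ]
  have hc : Continuous fun w : (ℝ × V) × V =>
      (𝓕⁻ (dil k χ.phi) : 𝓢(V, ℂ)) w.2 * F w.1.1 (w.1.2 - w.2) :=
    ((SchwartzMap.continuous _).comp continuous_snd).mul
      (hF.contDiff.continuous.comp (by fun_prop : Continuous fun w : (ℝ × V) × V =>
        (w.1.1, w.1.2 - w.2)))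
  exact (hc.stronglyMeasurable.integral_prod_right (ν := volume)).measurable

lemma blockS_timeIntegral (hF : IsTest F) (k : ℤ) (t : ℝ) (x : V) :
    χ.blockS k (hF.timeIntegral t) x = ∫ τ in Set.Ioc 0 t, χ.blockS k (hF.slice τ) x := by
  simp_rw [hF.blockS_slice_eq χ]
  rw [integral_integral_swap, LPF.blockS, mult_eq_convolution, convolution]
  · congr 1 with y
    rw [ContinuousLinearMap.mul_apply', timeIntegral_apply, integral_const_mul]
  · refine Continuous.integrable_of_hasCompactSupport ?_ ?_
    · exact ((SchwartzMap.continuous _).comp continuous_snd).mul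
        (hF.contDiff.continuous.comp (by fun_prop : Continuous fun w : ℝ × V => (w.1, x - w.2)))
    · exact (hF.hasCompactSupport.comp_homeomorph
        ((Homeomorph.refl ℝ).prodCongr (Homeomorph.subLeft x))).mul_left

lemma eLpNorm_eq_lintegral (f : V → ℂ) {p : ℝ} (hp : 0 < p) :
    eLpNorm f (ENNReal.ofReal p) volume = (∫⁻ x, ‖f x‖ₑ ^ p) ^ (1 / p) := by
  rw [← eLpNorm_rpow_eq f hp, ← ENNReal.rpow_mul, mul_one_div_cancel hp.ne', ENNReal.rpow_one]

lemma measurable_eLpNorm_blockS_slice (hF : IsTest F) (k : ℤ) {p : ℝ} (hp : 0 < p) :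
    Measurable fun t => eLpNorm (χ.blockS k (hF.slice t)) (ENNReal.ofReal p) volume := by
  simp_rw [eLpNorm_eq_lintegral _ hp]
  exact (Measurable.lintegral_prod_right'
    ((hF.measurable_blockS_slice χ k).enorm.pow_const p)).pow_const _

lemma measurable_besov (hF : IsTest F) (s : ℝ) {p : ℝ} (hp : 0 < p) :
    Measurable fun t => besov χ s p (F t) := by
  simp_rw [← hF.coe_slice, χ.besov_coe]
  exact Measurable.tsum fun k => (hF.measurable_eLpNorm_blockS_slice χ k hp).const_mul _

/-- Minkowski's inequality for the Besov norm of a time integral. -/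
lemma besov_timeIntegral_le (hF : IsTest F) (s : ℝ) {p : ℝ} (hp : 1 < p) (t : ℝ) :
    besov χ s p (hF.timeIntegral t) ≤ besovT χ s p (Set.Ioi 0) F := by
  have hp0 : 0 < p := by linarith
  rw [besovT]
  simp_rw [← hF.coe_slice, χ.besov_coe]
  rw [lintegral_tsum fun k =>
    ((hF.measurable_eLpNorm_blockS_slice χ k hp0).const_mul _).aemeasurable]
  refine ENNReal.tsum_le_tsum fun k => ?_
  rw [lintegral_const_mul _ (hF.measurable_eLpNorm_blockS_slice χ k hp0)]
  refine mul_le_mul_right ?_ _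
  refine le_trans ?_ (lintegral_mono_set (μ := volume)
    (Set.Ioc_subset_Ioi_self : Set.Ioc 0 t ⊆ Set.Ioi 0))
  simp_rw [eLpNorm_eq_lintegral _ hp0]
  refine lintegral_rpow_le_of_le_lintegral (h := fun τ x => ‖χ.blockS k (hF.slice τ) x‖ₑ)
    (SchwartzMap.continuous _).measurable.enorm (hF.measurable_blockS_slice χ k).enorm
    (fun x => ?_) hp ?_
  · rw [hF.blockS_timeIntegral]
    exact enorm_integral_le_lintegral_enorm _
  · rw [← eLpNorm_rpow_eq _ hp0]
    exact ENNReal.rpow_ne_top_of_nonneg hp0.le (eLpNorm_schwartz_ne_top _ _)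

end IsTest

end Test

/-! ### The nonlinear estimate on Euclidean space -/

section Euclidean

variable {N : ℕ}

namespace IsTest

lemma component {u : ℝ → Euc N → Euc N} (hu : SmoothCpt N u) (m : Fin N) :
    IsTest fun t y => u t y m :=
  (IsTest.mk hu.1 hu.2.1).clm_comp (EuclideanSpace.proj m : Euc N →L[ℝ] ℝ)

variable {f : ℝ → Euc N → ℝ}

lemma ofReal (hf : IsTest f) : IsTest fun t y => (f t y : ℂ) :=
  hf.clm_comp Complex.ofRealCLM

lemma pdv (hf : IsTest f) (i : Fin N) : IsTest fun t y => pdv i (f t) y := by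
  have h := hf.fderiv_apply (0, EuclideanSpace.single i 1)
  simp_rw [← hf.fderiv_slice] at h
  exact h

lemma dt (hf : IsTest f) : IsTest fun t y => deriv (fun τ => f τ y) t := by
  have h := hf.fderiv_apply (1, 0)
  simp_rw [← (hf.hasDerivAt_time _ _).deriv] at h
  exact h

lemma fderiv_ofReal (hf : IsTest f) (i : Fin N) (t : ℝ) (y : Euc N) :
    fderiv ℝ (Function.uncurry fun t y => (f t y : ℂ)) (t, y) (0, EuclideanSpace.single i 1) =
      ((MHD.pdv i (f t) y : ℝ) : ℂ) := by
  rw [← hf.ofReal.fderiv_slice]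
  have h := ((hf.contDiff_slice t).differentiable (by simp) y).hasFDerivAt
  have h2 := (Complex.ofRealCLM.hasFDerivAt (x := f t y)).comp y h
  rw [show (fun y => (f t y : ℂ)) = Complex.ofRealCLM ∘ f t from rfl, h2.fderiv]
  rfl

variable (χ : LPF (Euc N))

lemma gradBesov_slice (hf : IsTest f) (s p t : ℝ) :
    χ.gradBesov (EuclideanSpace.basisFun (Fin N) ℝ) s p (hf.ofReal.slice t) =
      ∑ i, besov χ s p fun y => ((MHD.pdv i (f t) y : ℝ) : ℂ) := by
  refine Finset.sum_congr rfl fun i _ => ?_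
  rw [lineDeriv_slice, coe_slice, EuclideanSpace.basisFun_apply]
  simp_rw [hf.fderiv_ofReal]

lemma gradBesov_timeIntegral_le (hf : IsTest f) (s : ℝ) {p : ℝ} (hp : 1 < p) (t : ℝ) :
    χ.gradBesov (EuclideanSpace.basisFun (Fin N) ℝ) s p (hf.ofReal.timeIntegral t) ≤
      ∑ i, besovT χ s p (Set.Ioi 0) fun t y => ((MHD.pdv i (f t) y : ℝ) : ℂ) := by
  refine Finset.sum_le_sum fun i _ => ?_
  rw [lineDeriv_timeIntegral, EuclideanSpace.basisFun_apply]
  refine (besov_timeIntegral_le χ _ s hp t).trans_eq ?_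
  simp_rw [hf.fderiv_ofReal]

lemma besov_slice_le (hf : IsTest f) (h0 : ∀ y, f 0 y = 0) (s : ℝ) {p : ℝ} (hp : 1 < p) {t : ℝ}
    (ht : 0 < t) :
    besov χ s p (fun y => (f t y : ℂ)) ≤
      besovT χ s p (Set.Ioi 0) fun t y => ((deriv (fun τ => f τ y) t : ℝ) : ℂ) := by
  refine le_of_eq_of_le (congrArg _ (funext fun y => ?_))
    (hf.dt.ofReal.besov_timeIntegral_le χ s hp t)
  have hc : Continuous fun τ => deriv (fun τ => f τ y) τ :=
    hf.dt.contDiff.continuous.comp (Continuous.prodMk_left y)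
  rw [timeIntegral_apply, ← intervalIntegral.integral_of_le ht.le,
    intervalIntegral.integral_ofReal,
    intervalIntegral.integral_deriv_eq_sub (fun τ _ => (hf.hasDerivAt_time τ y).differentiableAt)
      (hc.intervalIntegrable _ _), h0, sub_zero]

end IsTest

lemma besov_V3_le (χ : LPF (Euc N)) {s p : ℝ} (hp : 1 < p) {C : ℝ≥0∞}
    (hC : ∀ f g : 𝓢(Euc N, ℂ), besov χ s p (pmul f g) ≤
      C * χ.gradBesov (EuclideanSpace.basisFun (Fin N) ℝ) s p g * besov χ s p f)
    {Q : Fin N → Fin N → MvPolynomial (Fin N × Fin N) ℝ} (hQ : IsCofactorPoly N Q)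
    {u B : ℝ → Euc N → Euc N} (hu : SmoothCpt N u) (hB : SmoothCpt N B) (m : Fin N) {t : ℝ}
    (ht : 0 < t) :
    besov χ s p (fun y => ((∑ i : Fin N, ∑ j : Fin N,
        B t y i * ((if i = j then (1 : ℝ) else 0) + Pmat Q u t y i j) *
          pdv j (fun z => B t z m) y : ℝ) : ℂ)) ≤
      C * (N.factorial * (1 + C * EE χ s p u) ^ (N - 1)) * dtNorm χ s p B *
        ∑ j, ∑ l, besov χ s p
          (fun y => ((pdv l (pdv j fun z => B t z m) y : ℝ) : ℂ)) := by
  have hU := fun k => IsTest.component hu k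
  have hb := fun k => IsTest.component hB k
  let M : Euc N → Matrix (Fin N) (Fin N) ℝ :=
    fun y k l => ∫ τ in (0 : ℝ)..t, pdv l (fun z => u τ z k) y
  let g : Fin N → Fin N → 𝓢(Euc N, ℂ) := fun k l => ((hU k).pdv l).ofReal.timeIntegral t
  have hM : ∀ k l y, g k l y = (M y k l : ℂ) := fun k l y => by
    simp only [g, M]
    rw [IsTest.timeIntegral_apply, ← intervalIntegral.integral_of_le ht.le,
    intervalIntegral.integral_ofReal]
  have hE : ∀ k l, χ.gradBesov (EuclideanSpace.basisFun (Fin N) ℝ) s p (g k l) ≤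
      EE χ s p u := fun k l => by
    refine (IsTest.gradBesov_timeIntegral_le χ ((hU k).pdv l) s hp t).trans ?_
    rw [EE]
    refine le_trans ?_ (Finset.single_le_sum (fun _ _ => zero_le) (Finset.mem_univ k))
    exact Finset.sum_le_sum fun i _ =>
      Finset.single_le_sum (f := fun j => besovT χ s p (Set.Ioi 0)
        fun t y => ((pdv i (pdv j fun z => u t z k) y : ℝ) : ℂ))
        (fun _ _ => zero_le) (Finset.mem_univ l)
  choose F hF hFb using fun i j =>
    χ.exists_adjugate_mul hp.le hC M g hM hE i j ((hb i).ofReal.slice t)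
  let h : Fin N → 𝓢(Euc N, ℂ) := fun j => ((hb m).pdv j).ofReal.slice t
  have hV : (fun y => ((∑ i : Fin N, ∑ j : Fin N,
        B t y i * ((if i = j then (1 : ℝ) else 0) + Pmat Q u t y i j) *
          pdv j (fun z => B t z m) y : ℝ) : ℂ)) =
      ⇑(∑ i : Fin N, ∑ j : Fin N, pmul (F i j) (h j)) := by
    ext y
    simp only [_root_.sum_apply, pmul_apply, hF, h, IsTest.slice_apply]
    push_cast
    refine Finset.sum_congr rfl fun i _ => Finset.sum_congr rfl fun j _ => ?_
    have hadj : (if i = j then (1 : ℝ) else 0) + Pmat Q u t y i j =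
        Matrix.adjugate (1 + M y) i j := ((hQ i j).2 (M y)).symm
    rw [← hadj]
    push_cast
    ring
  rw [hV]
  set D := N.factorial * (1 + C * EE χ s p u) ^ (N - 1)
  refine (χ.besov_sum_le _ s hp.le _).trans ?_
  calc _ ≤ ∑ i, ∑ j, C * D * (besovT χ s p (Set.Ioi 0)
          fun t y => ((deriv (fun τ => B τ y i) t : ℝ) : ℂ)) *
        ∑ l, besov χ s p (fun y => ((pdv l (pdv j fun z => B t z m) y : ℝ) : ℂ)) := by
        refine Finset.sum_le_sum fun i _ => (χ.besov_sum_le _ s hp.le _).trans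
          (Finset.sum_le_sum fun j _ => (hC _ _).trans ?_)
        rw [((hb m).pdv j).gradBesov_slice χ s p t]
        refine (mul_le_mul_right ((hFb i j).trans (mul_le_mul_right ((hb i).besov_slice_le χ
          (fun y => by rw [hB.2.2 0 le_rfl]; rfl) s hp ht) D)) _).trans_eq ?_
        ring
    _ = _ := by
        simp_rw [← Finset.mul_sum, ← Finset.sum_mul, ← Finset.mul_sum]
        rfl

end Euclidean

end MHD

/-- **estimate (3.7).** For `N ≤ p < 2N − 1`, with `A = I + P`,
`‖V₃(u,B)‖_{L¹(ℝ₊;Ḃ^{−1+N/p}_{p,1})}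
  ≤ C (1 + ∑_{r=1}^{N−1} E(u)^r) ‖D²B‖_{L¹(ℝ₊;Ḃ^{−1+N/p}_{p,1})} ‖∂_t B‖_{L¹(ℝ₊;Ḃ^{−1+N/p}_{p,1})}`,
where `V₃(u,B) = ∑_{i,j} B_i A_{ij} ∂_j B`. -/
theorem V3_estimate
    (N : ℕ) (hN : 2 ≤ N) (p : ℝ) (hp1 : (N : ℝ) ≤ p) (hp2 : p < 2 * N - 1)
    (χ : LPF (Euc N))
    (Q : Fin N → Fin N → MvPolynomial (Fin N × Fin N) ℝ) (hQ : IsCofactorPoly N Q) :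
    ∃ C : ℝ, 0 < C ∧
      ∀ u B : ℝ → Euc N → Euc N, SmoothCpt N u → SmoothCpt N B →
        (∑ m : Fin N, besovT χ (-1 + N / p) p (Set.Ioi 0) (fun t y =>
          ((∑ i : Fin N, ∑ j : Fin N,
            B t y i * ((if i = j then (1 : ℝ) else 0) + Pmat Q u t y i j) *
              pdv j (fun z => B t z m) y : ℝ) : ℂ))) ≤
        ENNReal.ofReal C *
          ((1 + ∑ r ∈ Finset.Icc 1 (N - 1), EE χ (-1 + N / p) p u ^ r) *
            EE χ (-1 + N / p) p B * dtNorm χ (-1 + N / p) p B) := by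
  set s : ℝ := -1 + N / p with hs
  have hN' : (2 : ℝ) ≤ N := by exact_mod_cast hN
  have hp : 0 < p := by linarith
  have hfin : (Module.finrank ℝ (Euc N) : ℝ) = N := by rw [finrank_euclideanSpace_fin]
  have hsd : (Module.finrank ℝ (Euc N) : ℝ) / p - 1 = s := by rw [hfin, hs]; ring
  obtain ⟨C, hCt, hC⟩ := χ.besov_pmul_le (p := p) (EuclideanSpace.basisFun (Fin N) ℝ)
    (by linarith) (by rw [hfin, lt_div_iff₀ hp]; linarith) (by rw [hfin, div_le_one hp]; exact hp1)
  rw [hsd] at hC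
  set K : ℝ≥0∞ := C * (N.factorial * (1 + C) ^ (N - 1)) with hK
  have hKt : K ≠ ∞ := ENNReal.mul_ne_top hCt (ENNReal.mul_ne_top (ENNReal.natCast_ne_top _)
    (ENNReal.pow_ne_top (ENNReal.add_ne_top.2 ⟨ENNReal.one_ne_top, hCt⟩)))
  refine ⟨K.toReal + 1, by positivity, fun u B hu hB => ?_⟩
  have hmeas : ∀ m j l, Measurable fun t => besov χ s p
      (fun y => ((pdv l (pdv j fun z => B t z m) y : ℝ) : ℂ)) := fun m j l =>
    (((IsTest.component hB m).pdv j).pdv l).ofReal.measurable_besov χ s hp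
  set D := C * (N.factorial * (1 + C * EE χ s p u) ^ (N - 1)) * dtNorm χ s p B
  have hD : D ≤ K * (1 + ∑ r ∈ Finset.Icc 1 (N - 1), EE χ s p u ^ r) * dtNorm χ s p B := by
    refine mul_le_mul_left ?_ _
    rw [hK, mul_assoc, mul_assoc]
    exact mul_le_mul_right (mul_le_mul_right
      (one_add_mul_pow_le C _ (N - 1) (by omega)) _) _
  calc _ ≤ ∑ m : Fin N, D * ∑ j, ∑ l, besovT χ s p (Set.Ioi 0)
          fun t y => ((pdv l (pdv j fun z => B t z m) y : ℝ) : ℂ) := by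
        refine Finset.sum_le_sum fun m _ => ?_
        refine (setLIntegral_mono' measurableSet_Ioi fun t ht =>
          besov_V3_le χ (by linarith) (fun f g => hC f g) hQ hu hB m ht).trans_eq ?_
        rw [lintegral_const_mul _ (Finset.measurable_fun_sum _ fun j _ =>
          Finset.measurable_fun_sum _ fun l _ => hmeas m j l),
          lintegral_finsetSum _ fun j _ => Finset.measurable_fun_sum _ fun l _ => hmeas m j l]
        congr 1
        exact Finset.sum_congr rfl fun j _ => lintegral_finsetSum _ fun l _ => hmeas m j l
    _ = D * EE χ s p B := by
        rw [← Finset.mul_sum]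
        exact congrArg _ (Finset.sum_congr rfl fun m _ => Finset.sum_comm)
    _ ≤ K * (1 + ∑ r ∈ Finset.Icc 1 (N - 1), EE χ s p u ^ r) * dtNorm χ s p B * EE χ s p B :=
        mul_le_mul_left hD _
    _ = K * ((1 + ∑ r ∈ Finset.Icc 1 (N - 1), EE χ s p u ^ r) * EE χ s p B * dtNorm χ s p B) := by
        ring
    _ ≤ _ := by
        refine mul_le_mul_left ?_ _
        rw [← ENNReal.ofReal_toReal hKt]
        exact ENNReal.ofReal_le_ofReal (by simp)
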